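/- Let β ∈ C([0,∞)) be increasing with β(0) = 0 and such that γ(r) := ½ ∫₀^r ds/√β(s) < ∞ for every r > 0. Suppose the β-log-Sobolev inequality holds: β( μ(g² log g²) ) ≤ μ(|∇g|²) for all g ∈ C¹_b(ℝⁿ) with μ(g²) = 1. Then μ satisfies α(W₂(ν,μ)) ≤ I(ν|μ) for every probability measure ν on ℝⁿ, where α(s) := β(γ^{−1}(s)) for s ≥ 0. -/

import Mathlib

open MeasureTheory ENNReal NNReal Classical

/-- A coupling of `ν` and `μ`. -/
def IsCoupling {n : ℕ}
    (π : Measure (EuclideanSpace ℝ (Fin n) × EuclideanSpace ℝ (Fin n)))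
    (ν μ : Measure (EuclideanSpace ℝ (Fin n))) : Prop :=
  π.map Prod.fst = ν ∧ π.map Prod.snd = μ

/-- The `L^p`-Wasserstein distance for the Euclidean distance. -/
noncomputable def wassersteinDist {n : ℕ} (p : ℝ)
    (ν μ : Measure (EuclideanSpace ℝ (Fin n))) : ℝ≥0∞ :=
  (⨅ (π : Measure (EuclideanSpace ℝ (Fin n) × EuclideanSpace ℝ (Fin n)))
      (_ : IsCoupling π ν μ), ∫⁻ q, edist q.1 q.2 ^ p ∂π) ^ (1 / p)

/-- The relative entropy (Kullback information) `H(ν|μ)`. -/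
noncomputable def relEntropy {n : ℕ}
    (ν μ : Measure (EuclideanSpace ℝ (Fin n))) : ℝ≥0∞ :=
  if ν ≪ μ ∧ Integrable (llr ν μ) ν then ENNReal.ofReal (∫ x, llr ν μ x ∂ν) else ⊤

/-- The Fisher information `I(ν|μ) = ∫ |∇√f|² dμ` for `ν = fμ` with `√f ∈ H¹(μ)`,
and `+∞` otherwise. -/
noncomputable def fisherInfo {n : ℕ}
    (ν μ : Measure (EuclideanSpace ℝ (Fin n))) : ℝ≥0∞ :=
  ⨅ (f : EuclideanSpace ℝ (Fin n) → ℝ) (_ : ∀ x, 0 ≤ f x)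
    (_ : ν = μ.withDensity fun x => ENNReal.ofReal (f x))
    (_ : Differentiable ℝ fun x => Real.sqrt (f x)),
    ∫⁻ x, (‖gradient (fun y => Real.sqrt (f y)) x‖₊ : ℝ≥0∞) ^ 2 ∂μ

section SoftMax
variable {ι : Type*} [Fintype ι]

/-- The sum `∑ exp (a i / ε)`. -/
noncomputable def softSum (ε : ℝ) (a : ι → ℝ) : ℝ := ∑ i, Real.exp (a i / ε)

/-- The exponential of the soft maximum `ε log ∑ exp (a i / ε)`. -/
noncomputable def softExp (ε : ℝ) (a : ι → ℝ) : ℝ := softSum ε a ^ ε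

/-- The share of the index `i` in `softExp ε a`. -/
noncomputable def softPart (ε : ℝ) (a : ι → ℝ) (i : ι) : ℝ :=
  softSum ε a ^ (ε - 1) * Real.exp (a i / ε)

lemma softSum_pos [Nonempty ι] (ε : ℝ) (a : ι → ℝ) : 0 < softSum ε a :=
  Finset.sum_pos (fun _ _ => Real.exp_pos _) Finset.univ_nonempty

lemma softExp_pos [Nonempty ι] (ε : ℝ) (a : ι → ℝ) : 0 < softExp ε a :=
  Real.rpow_pos_of_pos (softSum_pos ε a) _

lemma softPart_pos [Nonempty ι] (ε : ℝ) (a : ι → ℝ) (i : ι) : 0 < softPart ε a i :=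
  mul_pos (Real.rpow_pos_of_pos (softSum_pos ε a) _) (Real.exp_pos _)

lemma sum_softPart [Nonempty ι] (ε : ℝ) (a : ι → ℝ) : ∑ i, softPart ε a i = softExp ε a := by
  simp only [softPart, ← Finset.mul_sum]
  change softSum ε a ^ (ε - 1) * softSum ε a = _
  rw [Real.rpow_sub_one (softSum_pos ε a).ne', div_mul_cancel₀ _ (softSum_pos ε a).ne', softExp]

lemma exp_div_le_softSum (ε : ℝ) (a : ι → ℝ) (i : ι) : Real.exp (a i / ε) ≤ softSum ε a :=
  Finset.single_le_sum (f := fun i => Real.exp (a i / ε)) (fun _ _ => (Real.exp_pos _).le)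
    (Finset.mem_univ i)

lemma softPart_le_softExp [Nonempty ι] (ε : ℝ) (a : ι → ℝ) (i : ι) :
    softPart ε a i ≤ softExp ε a := by
  rw [← sum_softPart]
  exact Finset.single_le_sum (fun j _ => (softPart_pos ε a j).le) (Finset.mem_univ i)

lemma exp_le_softExp {ε : ℝ} (hε : 0 < ε) (a : ι → ℝ) (i : ι) :
    Real.exp (a i) ≤ softExp ε a := by
  have h := Real.rpow_le_rpow (Real.exp_pos _).le (exp_div_le_softSum ε a i) hε.le
  rwa [← Real.exp_mul, div_mul_cancel₀ _ hε.ne'] at h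

lemma softPart_le_exp [Nonempty ι] {ε : ℝ} (hε : 0 < ε) (hε1 : ε ≤ 1) (a : ι → ℝ) (i : ι) :
    softPart ε a i ≤ Real.exp (a i) := by
  have h := Real.rpow_le_rpow_of_nonpos (Real.exp_pos _) (exp_div_le_softSum ε a i)
    (show ε - 1 ≤ 0 by linarith)
  calc softPart ε a i ≤ Real.exp (a i / ε) ^ (ε - 1) * Real.exp (a i / ε) :=
        mul_le_mul_of_nonneg_right h (Real.exp_pos _).le
    _ = Real.exp (a i) := by
        rw [← Real.exp_mul, ← Real.exp_add]
        congr 1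
        field_simp
        ring

lemma softExp_le {ε M : ℝ} (hε : 0 < ε) (a : ι → ℝ) (h : ∀ i, a i ≤ M) :
    softExp ε a ≤ (Fintype.card ι * Real.exp (M / ε)) ^ ε := by
  refine Real.rpow_le_rpow (Finset.sum_nonneg fun _ _ => (Real.exp_pos _).le) ?_ hε.le
  refine (Finset.sum_le_card_nsmul _ _ (Real.exp (M / ε)) fun i _ => ?_).trans ?_
  · gcongr
    exact h i
  · simp

lemma continuous_softSum (ε : ℝ) : Continuous (softSum ε : (ι → ℝ) → ℝ) := by
  unfold softSum; fun_prop

lemma continuous_softExp [Nonempty ι] (ε : ℝ) : Continuous (softExp ε : (ι → ℝ) → ℝ) :=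
  (continuous_softSum ε).rpow_const fun a => Or.inl (softSum_pos ε a).ne'

lemma continuous_softPart [Nonempty ι] (ε : ℝ) (i : ι) :
    Continuous fun a : ι → ℝ => softPart ε a i :=
  ((continuous_softSum ε).rpow_const fun a => Or.inl (softSum_pos ε a).ne').mul (by fun_prop)

lemma hasDerivAt_softExp [Nonempty ι] {ε : ℝ} (hε : 0 < ε) {a : ℝ → ι → ℝ} {a' : ι → ℝ} {t : ℝ}
    (h : ∀ i, HasDerivAt (fun t => a t i) (a' i) t) :
    HasDerivAt (fun t => softExp ε (a t)) (∑ i, a' i * softPart ε (a t) i) t := by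
  have h1 : HasDerivAt (fun t => softSum ε (a t)) (∑ i, Real.exp (a t i / ε) * (a' i / ε)) t := by
    unfold softSum
    exact HasDerivAt.fun_sum fun i _ => ((h i).div_const ε).exp
  have h2 := h1.rpow_const (p := ε) (Or.inl (softSum_pos ε (a t)).ne')
  refine h2.congr_deriv ?_
  simp only [softPart, Finset.sum_mul]
  refine Finset.sum_congr rfl fun i _ => ?_
  field_simp

lemma log_softExp [Nonempty ι] (ε : ℝ) (a : ι → ℝ) :
    Real.log (softExp ε a) = ε * Real.log (softSum ε a) :=
  Real.log_rpow (softSum_pos ε a) _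

lemma sum_mul_softPart_le_softExp_mul_log [Nonempty ι] {ε : ℝ} (hε : 0 < ε) (a : ι → ℝ) :
    ∑ i, a i * softPart ε a i ≤ softExp ε a * Real.log (softExp ε a) := by
  rw [← sum_softPart, Finset.sum_mul, sum_softPart]
  refine Finset.sum_le_sum fun i _ => ?_
  rw [mul_comm]
  refine mul_le_mul_of_nonneg_left ?_ (softPart_pos ε a i).le
  rw [Real.le_log_iff_exp_le (softExp_pos ε a)]
  exact exp_le_softExp hε a i

lemma softExp_mul_log_le [Nonempty ι] {ε : ℝ} (hε : 0 < ε) (a : ι → ℝ) :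
    softExp ε a * Real.log (softExp ε a) ≤
      ∑ i, a i * softPart ε a i + ε * (Fintype.card ι - 1) * softExp ε a := by
  have hS := softSum_pos ε a
  have key : ∀ i, softPart ε a i * (ε * Real.log (softSum ε a)) ≤
      a i * softPart ε a i + ε * (softExp ε a - softPart ε a i) := by
    intro i
    have h1 := Real.log_le_sub_one_of_pos (div_pos hS (Real.exp_pos (a i / ε)))
    rw [Real.log_div hS.ne' (Real.exp_pos _).ne', Real.log_exp] at h1
    have h2 : softPart ε a i * (softSum ε a / Real.exp (a i / ε)) = softExp ε a := by
      rw [softPart, softExp, Real.rpow_sub_one hS.ne']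
      field_simp
    have h3 := mul_le_mul_of_nonneg_left h1 (softPart_pos ε a i).le
    rw [mul_sub, mul_sub, h2] at h3
    have h4 := mul_le_mul_of_nonneg_left h3 hε.le
    have h5 : ε * (softPart ε a i * (a i / ε)) = a i * softPart ε a i := by
      field_simp
    nlinarith
  have h := Finset.sum_le_sum fun i (_ : i ∈ Finset.univ) => key i
  rw [← Finset.sum_mul, sum_softPart, ← log_softExp, Finset.sum_add_distrib, ← Finset.mul_sum,
    Finset.sum_sub_distrib, sum_softPart] at h
  refine h.trans (le_of_eq ?_)
  simp
  ring

end SoftMax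

section Quadratic

/-- The quadratic profile `i ↦ m i - s ‖x - y i‖² / 2`. -/
noncomputable def quadProfile {E ι : Type*} [NormedAddCommGroup E] (y : ι → E) (m : ι → ℝ)
    (s : ℝ) (x : E) (i : ι) : ℝ :=
  m i - s * (‖x - y i‖ ^ 2 / 2)

variable {E : Type*} [NormedAddCommGroup E] [InnerProductSpace ℝ E]
variable {ι : Type*} [Fintype ι]

lemma contDiff_sqrt_softExp [Nonempty ι] (y : ι → E) (ε : ℝ) (m : ι → ℝ) (s : ℝ) :
    ContDiff ℝ 1 fun x => softSum ε (quadProfile y m s x) ^ (ε / 2) := by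
  refine ContDiff.rpow_const_of_ne ?_ fun x => (softSum_pos ε _).ne'
  unfold softSum quadProfile
  refine ContDiff.sum fun i _ => ContDiff.exp ?_
  refine ContDiff.div_const (contDiff_const.sub (contDiff_const.mul ?_)) _
  exact ((contDiff_id.sub contDiff_const).norm_sq ℝ).div_const _

lemma norm_fderiv_sqrt_softExp_sq_le [Nonempty ι] (y : ι → E) {ε : ℝ} (hε : 0 < ε)
    (m : ι → ℝ) (s : ℝ) (x : E) :
    ‖fderiv ℝ (fun x => softSum ε (quadProfile y m s x) ^ (ε / 2)) x‖ ^ 2 ≤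
      s ^ 2 / 2 * ∑ i, ‖x - y i‖ ^ 2 / 2 * softPart ε (quadProfile y m s x) i := by
  set S := softSum ε (quadProfile y m s x) with hSdef
  have hS : 0 < S := softSum_pos ε _
  set e : ι → ℝ := fun i => Real.exp (quadProfile y m s x i / ε) with he
  have hsum : HasFDerivAt (fun x => softSum ε (quadProfile y m s x))
      (∑ i, e i • (-(s / ε) • innerSL ℝ (x - y i))) x := by
    unfold softSum
    refine HasFDerivAt.fun_sum fun i _ => HasFDerivAt.exp ?_
    unfold quadProfile
    have h1 : HasFDerivAt (fun x => ‖x - y i‖ ^ 2) (2 • innerSL ℝ (x - y i)) x := by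
      have := (hasStrictFDerivAt_norm_sq (x - y i)).hasFDerivAt.comp x
        ((hasFDerivAt_id x).sub_const (y i))
      exact this.congr_fderiv (by ext; simp)
    have h2 := (((h1.mul_const (1 / 2 : ℝ)).const_mul s).const_sub (m i)).mul_const ε⁻¹
    refine (h2.congr_fderiv ?_).congr_of_eventuallyEq ?_
    · ext v
      simp
      field_simp
    · filter_upwards with z
      simp only [div_eq_mul_inv, one_mul]
  have hd := hsum.rpow_const (p := ε / 2) (Or.inl hS.ne')
  rw [hd.fderiv]
  have hb : ‖∑ i, e i • (-(s / ε) • innerSL ℝ (x - y i))‖ ≤ |s| / ε * ∑ i, e i * ‖x - y i‖ := by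
    refine (norm_sum_le _ _).trans ?_
    rw [Finset.mul_sum]
    refine Finset.sum_le_sum fun i _ => le_of_eq ?_
    rw [norm_smul, norm_smul, innerSL_apply_norm, Real.norm_eq_abs, Real.norm_eq_abs, abs_neg,
      abs_div, abs_of_pos hε, abs_of_pos (Real.exp_pos _)]
    ring
  have hcs : (∑ i, e i * ‖x - y i‖) ^ 2 ≤ S * ∑ i, e i * ‖x - y i‖ ^ 2 := by
    have := Finset.sum_sq_le_sum_mul_sum_of_sq_le_mul Finset.univ
      (r := fun i => e i * ‖x - y i‖) (f := e) (g := fun i => e i * ‖x - y i‖ ^ 2)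
      (fun i _ => (Real.exp_pos _).le)
      (fun i _ => mul_nonneg (Real.exp_pos _).le (sq_nonneg _)) (fun i _ => le_of_eq (by ring))
    exact this
  rw [norm_smul, Real.norm_eq_abs, mul_pow, sq_abs]
  have hpow : (S ^ (ε / 2 - 1)) ^ 2 * S = S ^ (ε - 1) := by
    rw [← Real.rpow_natCast, ← Real.rpow_mul hS.le, ← Real.rpow_add_one hS.ne']
    congr 1
    push_cast
    ring
  calc (ε / 2 * S ^ (ε / 2 - 1)) ^ 2 * ‖∑ i, e i • (-(s / ε) • innerSL ℝ (x - y i))‖ ^ 2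
      ≤ (ε / 2 * S ^ (ε / 2 - 1)) ^ 2 * (|s| / ε * ∑ i, e i * ‖x - y i‖) ^ 2 := by gcongr
    _ = s ^ 2 / 4 * (S ^ (ε / 2 - 1)) ^ 2 * (∑ i, e i * ‖x - y i‖) ^ 2 := by
        rw [mul_pow, mul_pow, div_pow |s|, sq_abs]
        field_simp
        ring
    _ ≤ s ^ 2 / 4 * (S ^ (ε / 2 - 1)) ^ 2 * (S * ∑ i, e i * ‖x - y i‖ ^ 2) := by gcongr
    _ = s ^ 2 / 4 * ((S ^ (ε / 2 - 1)) ^ 2 * S) * ∑ i, e i * ‖x - y i‖ ^ 2 := by ring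
    _ = s ^ 2 / 2 * ∑ i, ‖x - y i‖ ^ 2 / 2 * softPart ε (quadProfile y m s x) i := by
        rw [hpow, Finset.mul_sum, Finset.mul_sum]
        refine Finset.sum_congr rfl fun i _ => ?_
        simp only [softPart, ← hSdef, he]
        ring

end Quadratic

lemma continuous_quadProfile_right {E ι : Type*} [NormedAddCommGroup E] (y : ι → E) (m : ι → ℝ)
    (s : ℝ) :
    Continuous fun x => quadProfile y m s x := by
  unfold quadProfile; fun_prop

lemma quadProfile_le {E ι : Type*} [NormedAddCommGroup E] {y : ι → E} {m : ι → ℝ} {s : ℝ}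
    (hs : 0 ≤ s) (x : E) (i : ι) :
    quadProfile y m s x i ≤ m i := by
  have : 0 ≤ s * (‖x - y i‖ ^ 2 / 2) := by positivity
  unfold quadProfile
  linarith

lemma cost_mul_softPart_le {E ι : Type*} [NormedAddCommGroup E] [Fintype ι] [Nonempty ι]
    (y : ι → E) {ε : ℝ} (hε : 0 < ε) (hε1 : ε ≤ 1)
    (m : ι → ℝ) {s : ℝ} (hs : 0 < s) (i : ι) (x : E) :
    ‖x - y i‖ ^ 2 / 2 * softPart ε (quadProfile y m s x) i ≤ Real.exp (m i) / s := by
  have h1 := softPart_le_exp hε hε1 (quadProfile y m s x) i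
  set q := ‖x - y i‖ ^ 2 / 2 with hq
  have hq0 : 0 ≤ q := by positivity
  have h2 : Real.exp (quadProfile y m s x i) = Real.exp (m i) * Real.exp (-(s * q)) := by
    rw [← Real.exp_add]
    simp only [quadProfile, ← hq]
    ring_nf
  have h3 : s * q * Real.exp (-(s * q)) ≤ 1 := by
    have := Real.add_one_le_exp (s * q)
    rw [Real.exp_neg, ← div_eq_mul_inv, div_le_one (Real.exp_pos _)]
    linarith
  calc q * softPart ε (quadProfile y m s x) i
      ≤ q * (Real.exp (m i) * Real.exp (-(s * q))) := by rw [← h2]; gcongr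
    _ = Real.exp (m i) * (s * q * Real.exp (-(s * q))) / s := by field_simp
    _ ≤ Real.exp (m i) * 1 / s := by gcongr
    _ = _ := by rw [mul_one]

lemma measurable_cost {E ι : Type*} [NormedAddCommGroup E] [MeasurableSpace E] [BorelSpace E]
    (y : ι → E) (i : ι) : Measurable fun x : E => ‖x - y i‖ ^ 2 / 2 :=
  Continuous.measurable (by fun_prop)

lemma softExp_quadProfile_le {E ι : Type*} [NormedAddCommGroup E] [Fintype ι] {y : ι → E}
    {ε : ℝ} (hε : 0 < ε) {m : ι → ℝ} {M : ℝ}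
    (hm : ∀ i, m i ≤ M) {s : ℝ} (hs : 0 ≤ s) (x : E) :
    softExp ε (quadProfile y m s x) ≤ (Fintype.card ι * Real.exp (M / ε)) ^ ε :=
  softExp_le hε _ fun i => (quadProfile_le hs x i).trans (hm i)

lemma exists_softExp_quadProfile_le {E ι : Type*} [NormedAddCommGroup E] [Fintype ι] (y : ι → E)
    {ε : ℝ} (hε : 0 < ε) (m : ι → ℝ)
    {s : ℝ} (hs : 0 ≤ s) : ∃ C, ∀ x, softExp ε (quadProfile y m s x) ≤ C :=
  ⟨_, fun x => softExp_quadProfile_le hε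
    (fun i => Finset.single_le_sum (f := fun i => |m i|) (fun _ _ => abs_nonneg _)
      (Finset.mem_univ i) |>.trans' (le_abs_self _)) hs x⟩

section Dual
variable {E : Type*} [NormedAddCommGroup E] [MeasurableSpace E] [BorelSpace E]
variable {ι : Type*} [Fintype ι] [Nonempty ι]

/-- The dual functional `∑ p i m i + 1 - ∫ softExp ε (quadProfile y m s) dμ`. -/
noncomputable def dualFun (μ : Measure E) (y : ι → E) (p : ι → ℝ) (ε : ℝ) (m : ι → ℝ) (s : ℝ) :
    ℝ :=
  ∑ i, p i * m i + 1 - ∫ x, softExp ε (quadProfile y m s x) ∂μ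

lemma integrable_softExp (μ : Measure E) [IsFiniteMeasure μ] (y : ι → E) {ε : ℝ} (hε : 0 < ε)
    (m : ι → ℝ) {s : ℝ} (hs : 0 ≤ s) :
    Integrable (fun x => softExp ε (quadProfile y m s x)) μ := by
  obtain ⟨C, hC⟩ := exists_softExp_quadProfile_le y hε m hs
  refine Integrable.of_bound
    ((continuous_softExp ε).comp
      (continuous_quadProfile_right y m s)).measurable.aestronglyMeasurable
    C (Filter.Eventually.of_forall fun x => ?_)
  rw [Real.norm_of_nonneg (softExp_pos _ _).le]
  exact hC x

lemma measurable_softPart (y : ι → E) (ε : ℝ) (m : ι → ℝ) (s : ℝ) (i : ι) :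
    Measurable fun x => softPart ε (quadProfile y m s x) i :=
  ((continuous_softPart ε i).comp (continuous_quadProfile_right y m s)).measurable

lemma integrable_softPart (μ : Measure E) [IsFiniteMeasure μ] (y : ι → E) {ε : ℝ} (hε : 0 < ε)
    (m : ι → ℝ) {s : ℝ} (hs : 0 ≤ s) (i : ι) :
    Integrable (fun x => softPart ε (quadProfile y m s x) i) μ := by
  refine (integrable_softExp μ y hε m hs).mono'
    (measurable_softPart y ε m s i).aestronglyMeasurable (Filter.Eventually.of_forall fun x => ?_)
  rw [Real.norm_of_nonneg (softPart_pos _ _ _).le]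
  exact softPart_le_softExp _ _ _

lemma integrable_cost_mul_softPart (μ : Measure E) [IsFiniteMeasure μ] (y : ι → E) {ε : ℝ}
    (hε : 0 < ε) (hε1 : ε ≤ 1) (m : ι → ℝ) {s : ℝ} (hs : 0 < s) (i : ι) :
    Integrable (fun x => ‖x - y i‖ ^ 2 / 2 * softPart ε (quadProfile y m s x) i) μ := by
  refine Integrable.of_bound
    ((measurable_cost y i).mul (measurable_softPart y ε m s i)).aestronglyMeasurable
    (Real.exp (m i) / s) (Filter.Eventually.of_forall fun x => ?_)
  rw [Real.norm_of_nonneg (mul_nonneg (by positivity) (softPart_pos _ _ _).le)]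
  exact cost_mul_softPart_le y hε hε1 m hs i x

lemma hasDerivAt_integral_softExp_potential (μ : Measure E) [IsFiniteMeasure μ] (y : ι → E)
    {ε : ℝ} (hε : 0 < ε) (m : ι → ℝ) {s : ℝ} (hs : 0 ≤ s) (i : ι) :
    HasDerivAt (fun t : ℝ => ∫ x, softExp ε (quadProfile y (m + t • Pi.single i (1 : ℝ)) s x) ∂μ)
      (∫ x, softPart ε (quadProfile y m s x) i ∂μ) 0 := by
  set M := ∑ j, |m j| + 1
  have hM : ∀ t ∈ Metric.ball (0 : ℝ) 1, ∀ j, (m + t • (Pi.single i (1 : ℝ) : ι → ℝ)) j ≤ M := by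
    intro t ht j
    have h1 : |m j| ≤ ∑ j, |m j| :=
      Finset.single_le_sum (f := fun j => |m j|) (fun _ _ => abs_nonneg _) (Finset.mem_univ j)
    have h2 := le_abs_self (m j)
    have h3 : |t| < 1 := by simpa using ht
    have h4 := le_abs_self t
    have h5 : t * (Pi.single i (1 : ℝ) : ι → ℝ) j ≤ 1 := by
      by_cases hj : j = i
      · subst hj; simp; linarith
      · simp [hj]
    simp only [Pi.add_apply, Pi.smul_apply, smul_eq_mul, M]
    linarith
  have hmeas : ∀ t : ℝ, Measurable fun x =>
      softExp ε (quadProfile y (m + t • Pi.single i (1 : ℝ)) s x) := fun t =>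
    ((continuous_softExp ε).comp (continuous_quadProfile_right y _ s)).measurable
  have hbound : ∀ x, ∀ t ∈ Metric.ball (0 : ℝ) 1,
      ‖softPart ε (quadProfile y (m + t • Pi.single i (1 : ℝ)) s x) i‖ ≤
        (Fintype.card ι * Real.exp (M / ε)) ^ ε := by
    intro x t ht
    rw [Real.norm_of_nonneg (softPart_pos _ _ _).le]
    exact (softPart_le_softExp _ _ _).trans (softExp_quadProfile_le hε (hM t ht) hs x)
  have hderiv : ∀ x : E, ∀ t : ℝ, HasDerivAt
      (fun t : ℝ => softExp ε (quadProfile y (m + t • Pi.single i (1 : ℝ)) s x))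
      (softPart ε (quadProfile y (m + t • Pi.single i (1 : ℝ)) s x) i) t := by
    intro x t
    have h1 : ∀ j, HasDerivAt
        (fun t : ℝ => quadProfile y (m + t • Pi.single i (1 : ℝ)) s x j)
        ((Pi.single i (1 : ℝ) : ι → ℝ) j) t := by
      intro j
      simp only [quadProfile, Pi.add_apply, Pi.smul_apply, smul_eq_mul]
      simpa using (((hasDerivAt_id t).mul_const ((Pi.single i (1 : ℝ) : ι → ℝ) j)).const_add
        (m j)).sub_const (s * (‖x - y j‖ ^ 2 / 2))
    refine (hasDerivAt_softExp hε h1).congr_deriv ?_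
    simp [Pi.single_apply]
  have h := (hasDerivAt_integral_of_dominated_loc_of_deriv_le (μ := μ)
    (Metric.ball_mem_nhds (0 : ℝ) one_pos)
    (Filter.Eventually.of_forall fun t => (hmeas t).aestronglyMeasurable)
    (integrable_softExp μ y hε _ hs)
    (measurable_softPart y ε _ s i).aestronglyMeasurable
    (Filter.Eventually.of_forall hbound) (integrable_const _)
    (Filter.Eventually.of_forall fun x t _ => hderiv x t)).2
  simpa only [zero_smul, add_zero] using h

lemma hasDerivAt_integral_softExp_slope (μ : Measure E) [IsFiniteMeasure μ] (y : ι → E)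
    {ε : ℝ} (hε : 0 < ε) (hε1 : ε ≤ 1) (m : ι → ℝ) {s : ℝ} (hs : 0 < s) :
    HasDerivAt (fun t => ∫ x, softExp ε (quadProfile y m t x) ∂μ)
      (-∑ i, ∫ x, ‖x - y i‖ ^ 2 / 2 * softPart ε (quadProfile y m s x) i ∂μ) s := by
  have hball : ∀ t ∈ Metric.ball s (s / 2), s / 2 < t := by
    intro t ht
    rw [Metric.mem_ball, Real.dist_eq, abs_lt] at ht
    linarith
  have hmeas : ∀ t : ℝ, Measurable fun x => softExp ε (quadProfile y m t x) := fun t =>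
    ((continuous_softExp ε).comp (continuous_quadProfile_right y _ t)).measurable
  have hbound : ∀ x, ∀ t ∈ Metric.ball s (s / 2),
      ‖∑ i, -(‖x - y i‖ ^ 2 / 2) * softPart ε (quadProfile y m t x) i‖ ≤
        ∑ i, Real.exp (m i) / (s / 2) := by
    intro x t ht
    have ht := hball t ht
    have ht0 : 0 < t := by linarith
    refine (norm_sum_le _ _).trans (Finset.sum_le_sum fun i _ => ?_)
    rw [neg_mul, norm_neg,
      Real.norm_of_nonneg (mul_nonneg (by positivity) (softPart_pos _ _ _).le)]
    refine (cost_mul_softPart_le y hε hε1 m ht0 i x).trans ?_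
    gcongr
  have hderiv : ∀ x : E, ∀ t : ℝ, HasDerivAt (fun t => softExp ε (quadProfile y m t x))
      (∑ i, -(‖x - y i‖ ^ 2 / 2) * softPart ε (quadProfile y m t x) i) t := by
    intro x t
    refine hasDerivAt_softExp hε fun j => ?_
    simp only [quadProfile]
    simpa using ((hasDerivAt_id t).mul_const (‖x - y j‖ ^ 2 / 2)).const_sub (m j)
  have hmeas' : Measurable fun x =>
      ∑ i, -(‖x - y i‖ ^ 2 / 2) * softPart ε (quadProfile y m s x) i :=
    Finset.measurable_fun_sum _ fun i _ =>
      (measurable_cost y i).neg.mul (measurable_softPart y ε _ s i)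
  have h := (hasDerivAt_integral_of_dominated_loc_of_deriv_le (μ := μ)
    (Metric.ball_mem_nhds s (half_pos hs))
    (Filter.Eventually.of_forall fun t => (hmeas t).aestronglyMeasurable)
    (integrable_softExp μ y hε _ hs.le) hmeas'.aestronglyMeasurable
    (Filter.Eventually.of_forall hbound) (integrable_const _)
    (Filter.Eventually.of_forall fun x t _ => hderiv x t)).2
  refine h.congr_deriv ?_
  simp only [neg_mul, Finset.sum_neg_distrib, integral_neg]
  rw [integral_finsetSum _ fun i _ => integrable_cost_mul_softPart μ y hε hε1 m hs i]

lemma continuousOn_dualFun (μ : Measure E) [IsFiniteMeasure μ] (y : ι → E) (p : ι → ℝ)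
    {ε : ℝ} (hε : 0 < ε) (M : ℝ) :
    ContinuousOn (fun z : (ι → ℝ) × ℝ => dualFun μ y p ε z.1 z.2)
      {z | (∀ i, z.1 i ≤ M) ∧ 0 ≤ z.2} := by
  unfold dualFun
  refine ContinuousOn.sub (by fun_prop) ?_
  refine continuousOn_of_dominated (bound := fun _ => (Fintype.card ι * Real.exp (M / ε)) ^ ε)
    ?_ ?_ (integrable_const _) ?_
  · intro z _
    exact ((continuous_softExp ε).comp
      (continuous_quadProfile_right y _ z.2)).measurable.aestronglyMeasurable
  · intro z hz
    refine Filter.Eventually.of_forall fun x => ?_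
    rw [Real.norm_of_nonneg (softExp_pos _ _).le]
    exact softExp_quadProfile_le hε hz.1 hz.2 x
  · refine Filter.Eventually.of_forall fun x => Continuous.continuousOn ?_
    refine (continuous_softExp ε).comp ?_
    unfold quadProfile
    fun_prop

end Dual

section Optimizer
variable {E : Type*} [NormedAddCommGroup E] [MeasurableSpace E]
variable {ι : Type*} [Fintype ι]

/-- `(m, s)` maximizes `dualFun μ y p ε m s - s * w` under the constraint `ε ≤ s`. -/
def IsDualMax (μ : Measure E) (y : ι → E) (p : ι → ℝ) (ε w : ℝ) (m : ι → ℝ) (s : ℝ) : Prop :=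
  ε ≤ s ∧ ∀ m' s', ε ≤ s' →
    dualFun μ y p ε m' s' - s' * w ≤ dualFun μ y p ε m s - s * w

lemma exists_pos_mul_exp_le_integral_softExp [BorelSpace E] [Nonempty ι] (μ : Measure E)
    [IsProbabilityMeasure μ] (y : ι → E) {ε : ℝ} (hε : 0 < ε) (S : ℝ) :
    ∃ c, 0 < c ∧ ∀ m s, 0 ≤ s → s ≤ S → ∀ i,
      c * Real.exp (m i) ≤ ∫ x, softExp ε (quadProfile y m s x) ∂μ := by
  by_cases hS : 0 ≤ S
  swap
  · exact ⟨1, one_pos, fun m s h1 h2 => absurd (h1.trans h2) hS⟩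
  have hcont : Continuous fun x => Real.exp (-(S * ∑ i, ‖x - y i‖ ^ 2 / 2)) := by fun_prop
  have hint : Integrable (fun x => Real.exp (-(S * ∑ i, ‖x - y i‖ ^ 2 / 2))) μ := by
    refine Integrable.of_bound hcont.measurable.aestronglyMeasurable 1
      (Filter.Eventually.of_forall fun x => ?_)
    rw [Real.norm_of_nonneg (Real.exp_pos _).le, Real.exp_le_one_iff, neg_nonpos]
    exact mul_nonneg hS (Finset.sum_nonneg fun i _ => by positivity)
  refine ⟨∫ x, Real.exp (-(S * ∑ i, ‖x - y i‖ ^ 2 / 2)) ∂μ, integral_exp_pos hint, ?_⟩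
  intro m s hs hsS i
  rw [mul_comm, ← integral_const_mul]
  refine integral_mono (hint.const_mul _) (integrable_softExp μ y hε m hs) fun x => ?_
  refine le_trans ?_ (exp_le_softExp hε _ i)
  rw [← Real.exp_add, Real.exp_le_exp, quadProfile]
  have h1 : ‖x - y i‖ ^ 2 / 2 ≤ ∑ i, ‖x - y i‖ ^ 2 / 2 :=
    Finset.single_le_sum (f := fun i => ‖x - y i‖ ^ 2 / 2) (fun i _ => by positivity)
      (Finset.mem_univ i)
  have h2 : s * (‖x - y i‖ ^ 2 / 2) ≤ S * ∑ i, ‖x - y i‖ ^ 2 / 2 :=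
    mul_le_mul hsS h1 (by positivity) hS
  linarith

lemma sub_mul_exp_le {c : ℝ} (hc : 0 < c) (t : ℝ) :
    t - c * Real.exp t ≤ 2 * |Real.log (c / 2)| ∧
      t ≤ 2 * |Real.log (c / 2)| - (t - c * Real.exp t) := by
  have h1 : c * Real.exp t = 2 * Real.exp (t + Real.log (c / 2)) := by
    rw [Real.exp_add, Real.exp_log (by positivity)]
    ring
  have h2 := Real.add_one_le_exp (t + Real.log (c / 2))
  have h3 := neg_abs_le (Real.log (c / 2))
  have h4 := abs_nonneg (Real.log (c / 2))
  have h5 := Real.exp_pos (t + Real.log (c / 2))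
  constructor <;> linarith

theorem exists_isDualMax [BorelSpace E] [Nonempty ι] (μ : Measure E) [IsProbabilityMeasure μ]
    (y : ι → E) {p : ι → ℝ} (hp : ∀ i, 0 < p i) (hp1 : ∑ i, p i = 1) {ε : ℝ} (hε : 0 < ε)
    {H w₀ w : ℝ} (hw₀ : 0 ≤ w₀) (hw : w₀ < w)
    (hD : ∀ m s, 0 ≤ s → dualFun μ y p ε m s ≤ H + s * w₀) :
    ∃ m s, IsDualMax μ y p ε w m s := by
  set v := dualFun μ y p ε 0 ε - ε * w with hv
  set S := (H - v) / (w - w₀) with hS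
  have hww : 0 < w - w₀ := sub_pos.2 hw
  have hslope : ∀ m s, ε ≤ s → v ≤ dualFun μ y p ε m s - s * w → s ≤ S := by
    intro m s hs h
    have := hD m s (hε.le.trans hs)
    rw [hS, le_div_iff₀ hww]
    nlinarith
  obtain ⟨c, hc, hcZ⟩ := exists_pos_mul_exp_le_integral_softExp μ y hε S
  set A := 2 * |Real.log (c / 2)| with hA
  have hA0 : 0 ≤ A := by positivity
  set B := ∑ i, (|v| + 1 + A) / p i with hB
  have hBi : ∀ i, (|v| + 1 + A) / p i ≤ B := fun i =>
    Finset.single_le_sum (f := fun i => (|v| + 1 + A) / p i)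
      (fun i _ => div_nonneg (by positivity) (hp i).le) (Finset.mem_univ i)
  have hB0 : 0 ≤ B := Finset.sum_nonneg fun i _ => div_nonneg (by positivity) (hp i).le
  have hpot : ∀ m s, ε ≤ s → v ≤ dualFun μ y p ε m s - s * w → ∀ i, |m i| ≤ A + B := by
    intro m s hs h i
    have hs0 := hε.le.trans hs
    have hZ := hcZ m s hs0 (hslope m s hs h)
    have hZ' : ∑ i, p i * (c * Real.exp (m i)) ≤ ∫ x, softExp ε (quadProfile y m s x) ∂μ := by
      calc _ ≤ ∑ i, p i * ∫ x, softExp ε (quadProfile y m s x) ∂μ :=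
            Finset.sum_le_sum fun i _ => mul_le_mul_of_nonneg_left (hZ i) (hp i).le
        _ = _ := by rw [← Finset.sum_mul, hp1, one_mul]
    have h1 : v - 1 ≤ ∑ i, p i * (m i - c * Real.exp (m i)) := by
      simp only [mul_sub, Finset.sum_sub_distrib]
      unfold dualFun at h
      have : 0 ≤ s * w := mul_nonneg hs0 (hw₀.trans hw.le)
      linarith
    have h2 : ∑ j, p j * (m j - c * Real.exp (m j)) ≤
        p i * (m i - c * Real.exp (m i)) + A := by
      rw [← Finset.add_sum_erase _ _ (Finset.mem_univ i)]
      gcongr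
      calc _ ≤ ∑ j ∈ Finset.univ.erase i, p j * A :=
            Finset.sum_le_sum fun j _ =>
              mul_le_mul_of_nonneg_left (sub_mul_exp_le hc _).1 (hp j).le
        _ ≤ ∑ j, p j * A := Finset.sum_le_sum_of_subset_of_nonneg (Finset.erase_subset _ _)
              fun j _ _ => mul_nonneg (hp j).le hA0
        _ = A := by rw [← Finset.sum_mul, hp1, one_mul]
    have h3 : -B ≤ m i - c * Real.exp (m i) := by
      have h4 := hBi i
      have h5 := neg_abs_le v
      have h6 : -((|v| + 1 + A) / p i) ≤ m i - c * Real.exp (m i) := by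
        rw [← neg_div, div_le_iff₀ (hp i)]
        linarith
      linarith
    have h7 := (sub_mul_exp_le hc (m i)).2
    have h8 : 0 < c * Real.exp (m i) := mul_pos hc (Real.exp_pos _)
    rw [abs_le]
    constructor <;> linarith
  set K : Set ((ι → ℝ) × ℝ) :=
    (Set.univ.pi fun _ => Set.Icc (-(A + B)) (A + B)) ×ˢ Set.Icc ε S with hK
  have hKc : IsCompact K := (isCompact_univ_pi fun _ => isCompact_Icc).prod isCompact_Icc
  have hεS : ε ≤ S := hslope 0 ε le_rfl le_rfl
  have hmem0 : ((0 : ι → ℝ), ε) ∈ K := by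
    refine ⟨fun i _ => ⟨?_, ?_⟩, le_rfl, hεS⟩ <;> simp <;> linarith
  have hcont : ContinuousOn (fun z : (ι → ℝ) × ℝ => dualFun μ y p ε z.1 z.2 - z.2 * w) K := by
    refine ((continuousOn_dualFun μ y p hε (A + B)).mono ?_).sub (by fun_prop)
    rintro ⟨m, s⟩ ⟨h1, h2⟩
    exact ⟨fun i => (h1 i (Set.mem_univ i)).2, hε.le.trans h2.1⟩
  obtain ⟨⟨m, s⟩, hms, hmax⟩ := hKc.exists_isMaxOn ⟨_, hmem0⟩ hcont
  refine ⟨m, s, hms.2.1, fun m' s' hs' => ?_⟩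
  by_cases h : v ≤ dualFun μ y p ε m' s' - s' * w
  · refine hmax (a := (m', s')) ⟨fun i _ => ?_, hs', hslope m' s' hs' h⟩
    exact abs_le.1 (hpot m' s' hs' h i)
  · exact (not_le.1 h).le.trans (hmax hmem0)

namespace IsDualMax
variable [BorelSpace E] [Nonempty ι] {μ : Measure E} [IsProbabilityMeasure μ] {y : ι → E}
  {p : ι → ℝ} {ε w s : ℝ} {m : ι → ℝ}

lemma integral_softPart (h : IsDualMax μ y p ε w m s) (hε : 0 < ε) (i : ι) :
    ∫ x, softPart ε (quadProfile y m s x) i ∂μ = p i := by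
  have hs : 0 ≤ s := hε.le.trans h.1
  have hlin : HasDerivAt (fun t : ℝ => ∑ j, p j * (m + t • (Pi.single i (1 : ℝ) : ι → ℝ)) j + 1)
      (p i) 0 := by
    have : HasDerivAt (fun t : ℝ => ∑ j, p j * (m + t • (Pi.single i (1 : ℝ) : ι → ℝ)) j)
        (∑ j, p j * (Pi.single i (1 : ℝ) : ι → ℝ) j) 0 := by
      refine HasDerivAt.fun_sum fun j _ => HasDerivAt.const_mul _ ?_
      simp only [Pi.add_apply, Pi.smul_apply, smul_eq_mul]
      simpa using ((hasDerivAt_id (0 : ℝ)).mul_const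
        ((Pi.single i (1 : ℝ) : ι → ℝ) j)).const_add (m j)
    refine (this.add_const 1).congr_deriv ?_
    simp [Pi.single_apply]
  have hd := hlin.sub (hasDerivAt_integral_softExp_potential μ y hε m hs i)
  have hmax : IsLocalMax ((fun t : ℝ => ∑ j, p j * (m + t • (Pi.single i (1 : ℝ) : ι → ℝ)) j + 1) -
      fun t : ℝ => ∫ x, softExp ε (quadProfile y (m + t • Pi.single i (1 : ℝ)) s x) ∂μ) 0 := by
    refine Filter.Eventually.of_forall fun t => ?_
    have := h.2 (m + t • Pi.single i (1 : ℝ)) s h.1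
    simp only [Pi.sub_apply, zero_smul, add_zero]
    exact sub_le_sub_iff_right (s * w) |>.1 this
  linarith [hmax.hasDerivAt_eq_zero hd]

lemma integral_softExp (h : IsDualMax μ y p ε w m s) (hε : 0 < ε) (hp1 : ∑ i, p i = 1) :
    ∫ x, softExp ε (quadProfile y m s x) ∂μ = 1 := by
  simp_rw [← sum_softPart]
  rw [integral_finsetSum _ fun i _ => integrable_softPart μ y hε m (hε.le.trans h.1) i,
    Finset.sum_congr rfl fun i _ => h.integral_softPart hε i, hp1]

lemma hasDerivAt_slope (h : IsDualMax μ y p ε w m s) (hε : 0 < ε) (hε1 : ε ≤ 1) :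
    HasDerivAt (fun t => dualFun μ y p ε m t - t * w)
      ((∑ i, ∫ x, ‖x - y i‖ ^ 2 / 2 * softPart ε (quadProfile y m s x) i ∂μ) - w) s := by
  have hd := (hasDerivAt_integral_softExp_slope μ y hε hε1 m (hε.trans_le h.1)).const_sub
    (∑ i, p i * m i + 1)
  refine (hd.sub ((hasDerivAt_id s).mul_const w)).congr_deriv ?_
  ring

lemma cost_eq (h : IsDualMax μ y p ε w m s) (hε : 0 < ε) (hε1 : ε ≤ 1) (hs : ε < s) :
    ∑ i, ∫ x, ‖x - y i‖ ^ 2 / 2 * softPart ε (quadProfile y m s x) i ∂μ = w := by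
  have hmax : IsLocalMax (fun t => dualFun μ y p ε m t - t * w) s := by
    filter_upwards [lt_mem_nhds hs] with t ht using h.2 m t ht.le
  linarith [hmax.hasDerivAt_eq_zero (h.hasDerivAt_slope hε hε1)]

lemma cost_le (h : IsDualMax μ y p ε w m s) (hε : 0 < ε) (hε1 : ε ≤ 1) :
    ∑ i, ∫ x, ‖x - y i‖ ^ 2 / 2 * softPart ε (quadProfile y m s x) i ∂μ ≤ w := by
  have hd := (h.hasDerivAt_slope hε hε1).hasDerivWithinAt (s := Set.Ioi s)
  rw [hasDerivWithinAt_iff_tendsto_slope' (by simp)] at hd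
  have : ∀ᶠ t in nhdsWithin s (Set.Ioi s),
      slope (fun t => dualFun μ y p ε m t - t * w) s t ≤ 0 := by
    filter_upwards [self_mem_nhdsWithin] with t ht
    rw [slope_def_field]
    have ht : s < t := ht
    exact div_nonpos_of_nonpos_of_nonneg (sub_nonpos.2 (h.2 m t (h.1.trans ht.le)))
      (sub_pos.2 ht).le
  linarith [le_of_tendsto hd this]

lemma value_eq (h : IsDualMax μ y p ε w m s) (hε : 0 < ε) (hp1 : ∑ i, p i = 1) :
    dualFun μ y p ε m s = ∑ i, p i * m i := by
  rw [dualFun, h.integral_softExp hε hp1]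
  ring

lemma sum_integral_quadProfile (h : IsDualMax μ y p ε w m s) (hε : 0 < ε) (hε1 : ε ≤ 1) :
    Integrable (fun x => ∑ i, quadProfile y m s x i * softPart ε (quadProfile y m s x) i) μ ∧
    ∫ x, ∑ i, quadProfile y m s x i * softPart ε (quadProfile y m s x) i ∂μ =
      ∑ i, p i * m i -
        s * ∑ i, ∫ x, ‖x - y i‖ ^ 2 / 2 * softPart ε (quadProfile y m s x) i ∂μ := by
  have hs : 0 < s := hε.trans_le h.1
  have hI1 := fun i => integrable_softPart μ y hε m hs.le i
  have hI2 := fun i => integrable_cost_mul_softPart μ y hε hε1 m hs i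
  have hI : ∀ i, (fun x => quadProfile y m s x i * softPart ε (quadProfile y m s x) i) =
      fun x => m i * softPart ε (quadProfile y m s x) i -
        s * (‖x - y i‖ ^ 2 / 2 * softPart ε (quadProfile y m s x) i) := by
    intro i
    ext x
    rw [show quadProfile y m s x i * softPart ε (quadProfile y m s x) i =
      (m i - s * (‖x - y i‖ ^ 2 / 2)) * softPart ε (quadProfile y m s x) i from rfl]
    ring
  have hint : ∀ i ∈ Finset.univ, Integrable
      (fun x => quadProfile y m s x i * softPart ε (quadProfile y m s x) i) μ := by
    intro i _
    rw [hI i]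
    exact ((hI1 i).const_mul _).sub ((hI2 i).const_mul _)
  refine ⟨integrable_finsetSum _ hint, ?_⟩
  rw [integral_finsetSum _ hint, Finset.mul_sum, ← Finset.sum_sub_distrib]
  refine Finset.sum_congr rfl fun i _ => ?_
  rw [hI i, integral_sub ((hI1 i).const_mul _) ((hI2 i).const_mul _), integral_const_mul,
    integral_const_mul, h.integral_softPart hε i]
  ring

end IsDualMax

lemma integrable_softExp_mul_log [BorelSpace E] [Nonempty ι] (μ : Measure E) [IsFiniteMeasure μ]
    (y : ι → E) {ε : ℝ} (hε : 0 < ε) (m : ι → ℝ) {s : ℝ} (hs : 0 ≤ s) :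
    Integrable (fun x => softExp ε (quadProfile y m s x) *
      Real.log (softExp ε (quadProfile y m s x))) μ := by
  obtain ⟨C, hC⟩ := exists_softExp_quadProfile_le y hε m hs
  have hm : Measurable fun x => softExp ε (quadProfile y m s x) :=
    ((continuous_softExp ε).comp (continuous_quadProfile_right y m s)).measurable
  refine Integrable.of_bound (hm.mul hm.log).aestronglyMeasurable (1 + C * C)
    (Filter.Eventually.of_forall fun x => ?_)
  have hpos := softExp_pos ε (quadProfile y m s x)
  have h1 := Real.log_le_sub_one_of_pos hpos
  have h2 := Real.one_sub_inv_le_log_of_pos hpos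
  have h3 := mul_le_mul_of_nonneg_left h1 hpos.le
  have h4 := mul_le_mul_of_nonneg_left h2 hpos.le
  rw [mul_sub, mul_inv_cancel₀ hpos.ne'] at h4
  have h5 := hC x
  have h6 : softExp ε (quadProfile y m s x) * softExp ε (quadProfile y m s x) ≤ C * C :=
    mul_self_le_mul_self hpos.le h5
  have h7 : 0 ≤ C * C := mul_self_nonneg C
  rw [Real.norm_eq_abs, abs_le]
  constructor <;> nlinarith

namespace IsDualMax
variable [BorelSpace E] [Nonempty ι] {μ : Measure E} [IsProbabilityMeasure μ] {y : ι → E}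
  {p : ι → ℝ} {ε w s : ℝ} {m : ι → ℝ}

lemma value_le_entropy (h : IsDualMax μ y p ε w m s) (hε : 0 < ε) (hε1 : ε ≤ 1)
    (hp1 : ∑ i, p i = 1) :
    dualFun μ y p ε m s - s * w ≤ ∫ x, softExp ε (quadProfile y m s x) *
      Real.log (softExp ε (quadProfile y m s x)) ∂μ := by
  have hs : 0 < s := hε.trans_le h.1
  rw [h.value_eq hε hp1]
  obtain ⟨hint, h1⟩ := h.sum_integral_quadProfile hε hε1
  have h2 := mul_le_mul_of_nonneg_left (h.cost_le hε hε1) hs.le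
  have h3 := integral_mono hint (integrable_softExp_mul_log μ y hε m hs.le)
    fun x => sum_mul_softPart_le_softExp_mul_log hε _
  linarith

lemma entropy_le_value (h : IsDualMax μ y p ε w m s) (hε : 0 < ε) (hε1 : ε ≤ 1)
    (hp1 : ∑ i, p i = 1) (hw : 0 ≤ w) :
    ∫ x, softExp ε (quadProfile y m s x) * Real.log (softExp ε (quadProfile y m s x)) ∂μ ≤
      dualFun μ y p ε m s - s * w + ε * (Fintype.card ι - 1 + w) := by
  have hs : 0 < s := hε.trans_le h.1
  rw [h.value_eq hε hp1]
  obtain ⟨hint, h1⟩ := h.sum_integral_quadProfile hε hε1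
  have hF := (integrable_softExp μ y hε m hs.le).const_mul (ε * (Fintype.card ι - 1))
  have h3 := integral_mono (integrable_softExp_mul_log μ y hε m hs.le) (hint.add hF)
    fun x => softExp_mul_log_le hε _
  simp only [Pi.add_apply] at h3
  rw [integral_add hint hF, integral_const_mul, h.integral_softExp hε hp1, h1] at h3
  have h4 : s * (w - ∑ i, ∫ x, ‖x - y i‖ ^ 2 / 2 * softPart ε (quadProfile y m s x) i ∂μ) ≤
      ε * w := by
    rcases h.1.eq_or_lt with hs' | hs'
    · rw [← hs']
      refine mul_le_mul_of_nonneg_left (sub_le_self _ ?_) hε.le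
      exact Finset.sum_nonneg fun i _ => integral_nonneg fun x =>
        mul_nonneg (by positivity) (softPart_pos _ _ _).le
    · rw [h.cost_eq hε hε1 hs', sub_self, mul_zero]
      positivity
  linarith

end IsDualMax
end Optimizer

/-- The function `γ(r) = ½ ∫₀^r ds / √β(s)`. -/
noncomputable def halfInvSqrtIntegral (β : ℝ → ℝ) (r : ℝ) : ℝ :=
  (1 / 2) * ∫ s in (0 : ℝ)..r, 1 / Real.sqrt (β s)

/-- A continuous strictly increasing function on `[0, ∞)` vanishing at `0`, with `1 / √β` locally
integrable. -/
structure IsAdmissibleRate (β : ℝ → ℝ) : Prop where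
  continuousOn : ContinuousOn β (Set.Ici 0)
  strictMonoOn : StrictMonoOn β (Set.Ici 0)
  zero : β 0 = 0
  intervalIntegrable : ∀ r : ℝ, 0 < r →
    IntervalIntegrable (fun s => 1 / Real.sqrt (β s)) volume 0 r

namespace IsAdmissibleRate
variable {β : ℝ → ℝ}

lemma pos (h : IsAdmissibleRate β) {r : ℝ} (hr : 0 < r) : 0 < β r := by
  rw [← h.zero]
  exact h.strictMonoOn (Set.mem_Ici.2 le_rfl) hr.le hr

lemma intervalIntegrable_of_nonneg (h : IsAdmissibleRate β) {x y : ℝ} (hx : 0 ≤ x) (hy : 0 ≤ y) :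
    IntervalIntegrable (fun s => 1 / Real.sqrt (β s)) volume x y := by
  have key : ∀ r : ℝ, 0 ≤ r → IntervalIntegrable (fun s => 1 / Real.sqrt (β s)) volume 0 r := by
    intro r hr
    rcases hr.eq_or_lt with rfl | hr
    · exact IntervalIntegrable.refl
    · exact h.intervalIntegrable r hr
  exact (key x hx).symm.trans (key y hy)

lemma sub_div_le (h : IsAdmissibleRate β) {x y : ℝ} (hx : 0 ≤ x) (hxy : x ≤ y) :
    (y - x) / (2 * Real.sqrt (β y)) ≤ halfInvSqrtIntegral β y - halfInvSqrtIntegral β x := by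
  have h1 : halfInvSqrtIntegral β y - halfInvSqrtIntegral β x =
      (1 / 2) * ∫ s in x..y, 1 / Real.sqrt (β s) := by
    unfold halfInvSqrtIntegral
    rw [← mul_sub, intervalIntegral.integral_interval_sub_left
      (h.intervalIntegrable_of_nonneg le_rfl (hx.trans hxy))
      (h.intervalIntegrable_of_nonneg le_rfl hx)]
  have h2 : ∫ _ in x..y, 1 / Real.sqrt (β y) ≤ ∫ s in x..y, 1 / Real.sqrt (β s) := by
    refine intervalIntegral.integral_mono_on_of_le_Ioo hxy intervalIntegrable_const
      (h.intervalIntegrable_of_nonneg hx (hx.trans hxy)) fun s hs => ?_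
    have hs0 : 0 < s := hx.trans_lt hs.1
    refine one_div_le_one_div_of_le (Real.sqrt_pos.2 (h.pos hs0)) (Real.sqrt_le_sqrt ?_)
    exact (h.strictMonoOn hs0.le (hs0.le.trans hs.2.le) hs.2).le
  rw [intervalIntegral.integral_const, smul_eq_mul] at h2
  rw [h1]
  calc _ = 1 / 2 * ((y - x) * (1 / Real.sqrt (β y))) := by
        rw [mul_comm (2 : ℝ), ← div_div]; ring
    _ ≤ _ := by gcongr

lemma nonneg (h : IsAdmissibleRate β) {r : ℝ} (hr : 0 ≤ r) : 0 ≤ halfInvSqrtIntegral β r := by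
  have := h.sub_div_le le_rfl hr
  have h0 : halfInvSqrtIntegral β 0 = 0 := by simp [halfInvSqrtIntegral]
  have h1 : 0 ≤ (r - 0) / (2 * Real.sqrt (β r)) := div_nonneg (by linarith) (by positivity)
  linarith

lemma strictMonoOn_halfInvSqrtIntegral (h : IsAdmissibleRate β) :
    StrictMonoOn (halfInvSqrtIntegral β) (Set.Ici 0) := by
  intro x hx y hy hxy
  have h1 := h.sub_div_le hx hxy.le
  have h2 : 0 < (y - x) / (2 * Real.sqrt (β y)) :=
    div_pos (sub_pos.2 hxy) (mul_pos two_pos (Real.sqrt_pos.2 (h.pos (lt_of_le_of_lt hx hxy))))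
  linarith

lemma continuousOn_halfInvSqrtIntegral (h : IsAdmissibleRate β) :
    ContinuousOn (halfInvSqrtIntegral β) (Set.Ici 0) := by
  intro r hr
  have hr : 0 ≤ r := hr
  have h1 : ContinuousOn (halfInvSqrtIntegral β) (Set.Icc 0 (r + 1)) := by
    have := intervalIntegral.continuousOn_primitive_interval (a := (0 : ℝ)) (b := r + 1)
      (f := fun s => 1 / Real.sqrt (β s)) (μ := volume) (by
        rw [Set.uIcc_of_le (by linarith), integrableOn_Icc_iff_integrableOn_Ioc,
          ← intervalIntegrable_iff_integrableOn_Ioc_of_le (by linarith)]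
        exact h.intervalIntegrable_of_nonneg le_rfl (by linarith))
    rw [Set.uIcc_of_le (by linarith)] at this
    exact continuousOn_const.mul this
  refine (h1 r ⟨hr, by linarith⟩).mono_of_mem_nhdsWithin ?_
  rw [← Set.Ici_inter_Iic]
  exact Filter.inter_mem self_mem_nhdsWithin
    (mem_nhdsWithin_of_mem_nhds (Iic_mem_nhds (by linarith)))

/-- A differential inequality `√β(e) ≤ - e'` in integrated form, where the derivative of `e` is
encoded by subgradients `s` with respect to `W² / 2`. -/
theorem sub_le_halfInvSqrtIntegral (h : IsAdmissibleRate β) {a b S : ℝ} (ha : 0 < a) (hab : a ≤ b)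
    {e s : ℝ → ℝ} (he : ∀ W ∈ Set.Icc a b, 0 < e W)
    (hs : ∀ W ∈ Set.Icc a b, 0 ≤ s W) (hS : ∀ W ∈ Set.Icc a b, s W ≤ S)
    (hβe : ∀ W ∈ Set.Icc a b, β (e W) ≤ (s W * W / 2) ^ 2)
    (hsub : ∀ W ∈ Set.Icc a b, ∀ W' ∈ Set.Icc a b,
      e W - s W * ((W' ^ 2 - W ^ 2) / 2) ≤ e W') :
    b - a ≤ halfInvSqrtIntegral β (e a) := by
  have hanti : ∀ W ∈ Set.Icc a b, ∀ z ∈ Set.Icc a b, W ≤ z → e z ≤ e W := by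
    intro W hW z hz hWz
    have h1 := hsub z hz W hW
    have h2 : 0 ≤ s z * ((z ^ 2 - W ^ 2) / 2) := by
      have := pow_le_pow_left₀ (ha.le.trans hW.1) hWz 2
      exact mul_nonneg (hs z hz) (by linarith)
    linarith
  have hS0 : 0 ≤ S := (hs a ⟨le_rfl, hab⟩).trans (hS a ⟨le_rfl, hab⟩)
  have hb : 0 < b := ha.trans_le hab
  have hlip : ∀ W ∈ Set.Icc a b, ∀ z ∈ Set.Icc a b, W ≤ z → e W - e z ≤ S * b * (z - W) := by
    intro W hW z hz hWz
    have h1 := hsub W hW z hz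
    have h2 : (z ^ 2 - W ^ 2) / 2 ≤ b * (z - W) := by nlinarith [hW.2, hz.2]
    have h4 : 0 ≤ b * (z - W) := mul_nonneg hb.le (sub_nonneg.2 hWz)
    have h3 : s W * ((z ^ 2 - W ^ 2) / 2) ≤ S * (b * (z - W)) :=
      (mul_le_mul_of_nonneg_left h2 (hs W hW)).trans (mul_le_mul_of_nonneg_right (hS W hW) h4)
    linarith
  have hecont : ContinuousOn e (Set.Icc a b) := by
    have : LipschitzOnWith (Real.toNNReal (S * b)) e (Set.Icc a b) := by
      refine LipschitzOnWith.of_dist_le_mul fun x hx z hz => ?_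
      rw [Real.coe_toNNReal _ (mul_nonneg hS0 hb.le), Real.dist_eq, Real.dist_eq]
      rcases le_total x z with hxz | hxz
      · rw [abs_of_nonneg (sub_nonneg.2 (hanti x hx z hz hxz)), abs_sub_comm x z,
          abs_of_nonneg (sub_nonneg.2 hxz)]
        exact hlip x hx z hz hxz
      · rw [abs_sub_comm, abs_of_nonneg (sub_nonneg.2 (hanti z hz x hx hxz)),
          abs_of_nonneg (sub_nonneg.2 hxz)]
        exact hlip z hz x hx hxz
    exact this.continuousOn
  have hmaps : Set.MapsTo e (Set.Icc a b) (Set.Ici 0) := fun W hW => (he W hW).le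
  have hφcont : ContinuousOn (fun W => Real.sqrt (β (e W))) (Set.Icc a b) :=
    Real.continuous_sqrt.comp_continuousOn (h.continuousOn.comp hecont hmaps)
  have hfcont : ContinuousOn (fun W => halfInvSqrtIntegral β (e W)) (Set.Icc a b) :=
    h.continuousOn_halfInvSqrtIntegral.comp hecont hmaps
  have hmain := image_le_of_liminf_slope_right_le_deriv_boundary
    (f := fun W => halfInvSqrtIntegral β (e W))
    (B := fun W => halfInvSqrtIntegral β (e a) - (W - a)) (B' := fun _ => -1) hfcont (by simp)
    (by fun_prop)
    (fun W _ => (((hasDerivAt_id W).sub_const a).const_sub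
      (halfInvSqrtIntegral β (e a))).hasDerivWithinAt) ?_
    (Set.right_mem_Icc.2 hab)
  · have := h.nonneg (he b (Set.right_mem_Icc.2 hab)).le
    linarith
  intro W hW r hr
  have hWm : W ∈ Set.Icc a b := Set.Ico_subset_Icc_self hW
  have hφW : 0 < Real.sqrt (β (e W)) := Real.sqrt_pos.2 (h.pos (he W hWm))
  have hW0 : 0 < W := ha.trans_le hW.1
  have hmem : ∀ᶠ z in nhdsWithin W (Set.Ioi W), z ∈ Set.Icc a b := by
    filter_upwards [Ioo_mem_nhdsGT hW.2] with z hz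
    exact ⟨hW.1.trans hz.1.le, hz.2.le⟩
  have hφlim : Filter.Tendsto (fun z => Real.sqrt (β (e z))) (nhdsWithin W (Set.Ioi W))
      (nhds (Real.sqrt (β (e W)))) := by
    refine (hφcont W hWm).mono_left ?_
    exact nhdsWithin_le_iff.2 hmem
  have hlim : Filter.Tendsto
      (fun z => -(Real.sqrt (β (e z)) / Real.sqrt (β (e W)) * ((W + z) / (2 * z))))
      (nhdsWithin W (Set.Ioi W)) (nhds (-1)) := by
    have h1 : Filter.Tendsto (fun z : ℝ => (W + z) / (2 * z)) (nhdsWithin W (Set.Ioi W))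
        (nhds ((W + W) / (2 * W))) :=
      (ContinuousAt.div (by fun_prop) (by fun_prop) (by positivity)).mono_left nhdsWithin_le_nhds
    have h2 := ((hφlim.div_const (Real.sqrt (β (e W)))).mul h1).neg
    rwa [div_self hφW.ne', ← two_mul, div_self (by positivity), one_mul] at h2
  refine Filter.Eventually.frequently ?_
  filter_upwards [hlim.eventually (gt_mem_nhds hr), hmem, self_mem_nhdsWithin] with z hz hzm hWz
  have hWz : W < z := hWz
  refine lt_of_le_of_lt ?_ hz
  rw [slope_def_field, div_le_iff₀ (sub_pos.2 hWz)]
  have hz0 : 0 < z := hW0.trans hWz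
  have h1 := h.sub_div_le (he z hzm).le (hanti W hWm z hzm hWz.le)
  have h2 := hsub z hzm W hWm
  have h3 : Real.sqrt (β (e z)) ≤ s z * z / 2 :=
    Real.sqrt_le_iff.2 ⟨by have := hs z hzm; positivity, hβe z hzm⟩
  have h4 : Real.sqrt (β (e z)) * ((W + z) / z) * (z - W) ≤ e W - e z := by
    have h5 : Real.sqrt (β (e z)) * ((W + z) / z) * (z - W) ≤
        s z * z / 2 * ((W + z) / z) * (z - W) := by
      have : 0 ≤ z - W := sub_nonneg.2 hWz.le
      gcongr
    have h6 : s z * z / 2 * ((W + z) / z) * (z - W) = s z * ((z ^ 2 - W ^ 2) / 2) := by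
      field_simp
      ring
    linarith
  have h7 := div_le_div_of_nonneg_right h4 (mul_pos two_pos hφW).le
  have h8 : Real.sqrt (β (e z)) * ((W + z) / z) * (z - W) / (2 * Real.sqrt (β (e W))) =
      Real.sqrt (β (e z)) / Real.sqrt (β (e W)) * ((W + z) / (2 * z)) * (z - W) := by
    field_simp
  rw [h8] at h7
  linarith

end IsAdmissibleRate

section SemiDiscrete
variable {E : Type*} [NormedAddCommGroup E] [InnerProductSpace ℝ E] [MeasurableSpace E]
  [BorelSpace E]

/-- The `β`-log-Sobolev inequality for bounded `C¹` functions. -/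
def BetaLogSobolev (β : ℝ → ℝ) (μ : Measure E) : Prop :=
  ∀ g : E → ℝ, ContDiff ℝ 1 g → (∃ M, ∀ x, |g x| ≤ M) → (∫ x, g x ^ 2 ∂μ) = 1 →
    ENNReal.ofReal (β (∫ x, g x ^ 2 * Real.log (g x ^ 2) ∂μ)) ≤ ∫⁻ x, ‖fderiv ℝ g x‖ₑ ^ 2 ∂μ

/-- Densities `f i ≥ 0` of masses `p i`, whose transport to the points `y i` costs at most `c`. -/
structure IsTransportDensity {ι : Type*} [Fintype ι] (μ : Measure E) (y : ι → E) (p : ι → ℝ)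
    (c : ℝ) (f : ι → E → ℝ) : Prop where
  measurable : ∀ i, Measurable (f i)
  nonneg : ∀ i x, 0 ≤ f i x
  integrable : ∀ i, Integrable (f i) μ
  integral_eq : ∀ i, ∫ x, f i x ∂μ = p i
  integrable_cost : ∀ i, Integrable (fun x => ‖x - y i‖ ^ 2 * f i x) μ
  cost_le : ∑ i, ∫ x, ‖x - y i‖ ^ 2 * f i x ∂μ ≤ c

variable {ι : Type*} [Fintype ι] [Nonempty ι] {μ : Measure E} [IsProbabilityMeasure μ]
  {β : ℝ → ℝ} {y : ι → E} {p : ι → ℝ} {ε w s : ℝ} {m : ι → ℝ}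

lemma IsDualMax.rate_entropy_le (h : IsDualMax μ y p ε w m s) (hLSI : BetaLogSobolev β μ)
    (hε : 0 < ε) (hε1 : ε ≤ 1) (hp1 : ∑ i, p i = 1) :
    β (∫ x, softExp ε (quadProfile y m s x) * Real.log (softExp ε (quadProfile y m s x)) ∂μ) ≤
      s ^ 2 / 2 * w := by
  have hs : 0 < s := hε.trans_le h.1
  have hg2 : ∀ x, (softSum ε (quadProfile y m s x) ^ (ε / 2)) ^ 2 =
      softExp ε (quadProfile y m s x) := by
    intro x
    rw [softExp, ← Real.rpow_natCast, ← Real.rpow_mul (softSum_pos ε _).le]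
    norm_num
  obtain ⟨C, hC⟩ := exists_softExp_quadProfile_le y hε m hs.le
  have hw : 0 ≤ w := (Finset.sum_nonneg fun i _ => integral_nonneg fun x =>
    mul_nonneg (by positivity) (softPart_pos _ _ _).le).trans (h.cost_le hε hε1)
  have hlsi := hLSI _ (contDiff_sqrt_softExp y ε m s) ⟨1 + C, fun x => ?_⟩ ?_
  · simp only [hg2] at hlsi
    rw [← ENNReal.ofReal_le_ofReal_iff (by positivity)]
    refine hlsi.trans ?_
    have hint : Integrable
        (fun x => s ^ 2 / 2 * ∑ i, ‖x - y i‖ ^ 2 / 2 * softPart ε (quadProfile y m s x) i) μ :=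
      (integrable_finsetSum _ fun i _ =>
        integrable_cost_mul_softPart μ y hε hε1 m hs i).const_mul _
    calc _ ≤ ∫⁻ x, ENNReal.ofReal
          (s ^ 2 / 2 * ∑ i, ‖x - y i‖ ^ 2 / 2 * softPart ε (quadProfile y m s x) i) ∂μ := by
          refine lintegral_mono fun x => ?_
          rw [← ofReal_norm, ← ENNReal.ofReal_pow (norm_nonneg _)]
          exact ENNReal.ofReal_le_ofReal (norm_fderiv_sqrt_softExp_sq_le y hε m s x)
      _ = ENNReal.ofReal (∫ x,
          s ^ 2 / 2 * ∑ i, ‖x - y i‖ ^ 2 / 2 * softPart ε (quadProfile y m s x) i ∂μ) := by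
          rw [ofReal_integral_eq_lintegral_ofReal hint]
          exact Filter.Eventually.of_forall fun x => mul_nonneg (by positivity)
            (Finset.sum_nonneg fun i _ => mul_nonneg (by positivity) (softPart_pos _ _ _).le)
      _ ≤ _ := by
          refine ENNReal.ofReal_le_ofReal ?_
          rw [integral_const_mul, integral_finsetSum _ fun i _ =>
            integrable_cost_mul_softPart μ y hε hε1 m hs i]
          exact mul_le_mul_of_nonneg_left (h.cost_le hε hε1) (by positivity)
  · have h1 := hC x
    rw [← hg2] at h1
    rw [abs_le]
    constructor <;>
      nlinarith [sq_nonneg (softSum ε (quadProfile y m s x) ^ (ε / 2) - 1),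
        sq_nonneg (softSum ε (quadProfile y m s x) ^ (ε / 2) + 1)]
  · simp only [hg2]
    exact h.integral_softExp hε hp1

/-- Approximate semi-discrete transport at quadratic cost `b ^ 2`: the total density
`∑ i, f i` has small entropy. -/
theorem exists_isTransportDensity_entropy_le (hβ : IsAdmissibleRate β) (hLSI : BetaLogSobolev β μ)
    (hp : ∀ i, 0 < p i) (hp1 : ∑ i, p i = 1) (hε : 0 < ε) (hε1 : ε ≤ 1)
    {H w₀ a b : ℝ} (hH : 0 ≤ H) (hw₀ : 0 ≤ w₀)
    (hD : ∀ m s, 0 ≤ s → dualFun μ y p ε m s ≤ H + s * w₀)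
    (ha : 0 < a) (haw : w₀ < a ^ 2 / 2) (hab : halfInvSqrtIntegral β H < b - a) :
    ∃ f : ι → E → ℝ, IsTransportDensity μ y p (b ^ 2) f ∧
      Integrable (fun x => (∑ i, f i x) * Real.log (∑ i, f i x)) μ ∧
      ∫ x, (∑ i, f i x) * Real.log (∑ i, f i x) ∂μ ≤ ε * (Fintype.card ι - 1 + b ^ 2 / 2) := by
  have hab' : a ≤ b := by linarith [hβ.nonneg hH]
  have hex : ∀ W : ℝ, ∃ ms : (ι → ℝ) × ℝ, W ∈ Set.Icc a b →
      IsDualMax μ y p ε (W ^ 2 / 2) ms.1 ms.2 := by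
    intro W
    by_cases hW : W ∈ Set.Icc a b
    · have := pow_le_pow_left₀ ha.le hW.1 2
      obtain ⟨m, s, h⟩ := exists_isDualMax μ y hp hp1 hε (w := W ^ 2 / 2) hw₀ (by linarith) hD
      exact ⟨(m, s), fun _ => h⟩
    · exact ⟨(0, 0), fun h => absurd h hW⟩
  choose ms hms using hex
  obtain ⟨W, hW, heW⟩ : ∃ W ∈ Set.Icc a b,
      dualFun μ y p ε (ms W).1 (ms W).2 - (ms W).2 * (W ^ 2 / 2) ≤ 0 := by
    by_contra! hcon
    have hs : ∀ W ∈ Set.Icc a b, 0 ≤ (ms W).2 := fun W hW => hε.le.trans (hms W hW).1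
    have hgap : ∀ W ∈ Set.Icc a b, a ^ 2 / 2 ≤ W ^ 2 / 2 := fun W hW => by
      have := pow_le_pow_left₀ ha.le hW.1 2
      linarith
    have hbd := hβ.sub_le_halfInvSqrtIntegral ha hab' (S := H / (a ^ 2 / 2 - w₀))
      (e := fun W => dualFun μ y p ε (ms W).1 (ms W).2 - (ms W).2 * (W ^ 2 / 2))
      (s := fun W => (ms W).2) hcon hs ?_ ?_ ?_
    · have h1 := hD (ms a).1 (ms a).2 (hs a ⟨le_rfl, hab'⟩)
      have h2 := mul_le_mul_of_nonneg_left haw.le (hs a ⟨le_rfl, hab'⟩)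
      have h3 := hβ.strictMonoOn_halfInvSqrtIntegral.monotoneOn
        (hcon a ⟨le_rfl, hab'⟩).le hH (by linarith)
      linarith
    · intro W hW
      have h1 := hD (ms W).1 (ms W).2 (hs W hW)
      have h2 := hcon W hW
      have h3 := mul_le_mul_of_nonneg_left (hgap W hW) (hs W hW)
      rw [le_div_iff₀ (by linarith)]
      nlinarith
    · intro W hW
      have h1 := (hms W hW).value_le_entropy hε hε1 hp1
      have h2 := (hms W hW).rate_entropy_le hLSI hε hε1 hp1
      have h3 := hβ.strictMonoOn.monotoneOn (hcon W hW).le ((hcon W hW).le.trans h1) h1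
      calc _ ≤ _ := h3.trans h2
        _ = _ := by ring
    · intro W hW W' hW'
      have := (hms W' hW').2 (ms W).1 (ms W).2 (hms W hW).1
      linarith
  have hmax := hms W hW
  set m := (ms W).1
  set s := (ms W).2
  have hs : 0 < s := hε.trans_le hmax.1
  have hWb : W ^ 2 ≤ b ^ 2 := pow_le_pow_left₀ (ha.le.trans hW.1) hW.2 2
  have hcost : ∀ i, (fun x => ‖x - y i‖ ^ 2 * softPart ε (quadProfile y m s x) i) =
      fun x => 2 * (‖x - y i‖ ^ 2 / 2 * softPart ε (quadProfile y m s x) i) := by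
    intro i
    ext x
    ring
  refine ⟨fun i x => softPart ε (quadProfile y m s x) i, ⟨measurable_softPart y ε m s,
    fun i x => (softPart_pos _ _ _).le, integrable_softPart μ y hε m hs.le,
    hmax.integral_softPart hε, fun i => ?_, ?_⟩, ?_, ?_⟩
  · rw [hcost]
    exact (integrable_cost_mul_softPart μ y hε hε1 m hs i).const_mul _
  · simp only [hcost, integral_const_mul, ← Finset.mul_sum]
    linarith [hmax.cost_le hε hε1]
  · simp only [sum_softPart]
    exact integrable_softExp_mul_log μ y hε m hs.le
  · simp only [sum_softPart]
    have h1 := hmax.entropy_le_value hε hε1 hp1 (by positivity)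
    have h2 : ε * (Fintype.card ι - 1 + W ^ 2 / 2) ≤ ε * (Fintype.card ι - 1 + b ^ 2 / 2) := by
      gcongr
    linarith

end SemiDiscrete

lemma sq_sqrt_sub_one_le {t : ℝ} (ht : 0 ≤ t) :
    (Real.sqrt t - 1) ^ 2 ≤ t * Real.log t - t + 1 := by
  rcases ht.eq_or_lt with rfl | ht
  · simp
  have hu := Real.sqrt_pos.2 ht
  obtain ⟨u, hu'⟩ : ∃ u, u = Real.sqrt t := ⟨_, rfl⟩
  rw [← hu'] at hu ⊢
  have htu : t = u ^ 2 := by rw [hu', Real.sq_sqrt ht.le]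
  have h1 := mul_le_mul_of_nonneg_left (Real.one_sub_inv_le_log_of_pos hu) (sq_nonneg u)
  have h2 : u ^ 2 * (1 - u⁻¹) = u ^ 2 - u := by field_simp
  rw [htu, Real.log_pow]
  push_cast
  nlinarith

lemma abs_sub_one_le_mul_entropy {t τ : ℝ} (ht : 0 ≤ t) (hτ : 0 < τ) :
    |t - 1| ≤ 2 / τ * (t * Real.log t - t + 1) + τ / 4 * (t + 1) := by
  have h1 := sq_sqrt_sub_one_le ht
  obtain ⟨u, hu⟩ : ∃ u, u = Real.sqrt t := ⟨_, rfl⟩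
  have hu0 : 0 ≤ u := hu ▸ Real.sqrt_nonneg t
  have htu : t = u ^ 2 := by rw [hu, Real.sq_sqrt ht]
  rw [← hu] at h1
  have h2 : |t - 1| = |u - 1| * (u + 1) := by
    rw [htu, show u ^ 2 - 1 = (u - 1) * (u + 1) by ring, abs_mul,
      abs_of_nonneg (by linarith : (0 : ℝ) ≤ u + 1)]
  have h3 : |u - 1| * (u + 1) ≤ 2 / τ * (u - 1) ^ 2 + τ / 8 * (u + 1) ^ 2 := by
    rw [← sq_abs (u - 1)]
    have h4 : 2 / τ * |u - 1| ^ 2 + τ / 8 * (u + 1) ^ 2 - |u - 1| * (u + 1) =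
        2 / τ * (|u - 1| - τ / 4 * (u + 1)) ^ 2 := by
      field_simp
      ring
    have h5 : 0 ≤ 2 / τ * (|u - 1| - τ / 4 * (u + 1)) ^ 2 := by positivity
    linarith
  have h6 : 2 / τ * (u - 1) ^ 2 ≤ 2 / τ * (t * Real.log t - t + 1) := by gcongr
  have h7 : τ / 8 * (u + 1) ^ 2 ≤ τ / 4 * (t + 1) := by
    rw [htu]
    nlinarith [mul_nonneg hτ.le (sq_nonneg (u - 1))]
  linarith

section
variable {X : Type*} [MeasurableSpace X]

lemma integral_abs_sub_one_le {μ : Measure X} [IsProbabilityMeasure μ] {F : X → ℝ}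
    (hF0 : ∀ x, 0 ≤ F x) (hF : Integrable F μ) (hF1 : ∫ x, F x ∂μ = 1)
    (hlog : Integrable (fun x => F x * Real.log (F x)) μ) {τ : ℝ} (hτ : 0 < τ)
    (hH : ∫ x, F x * Real.log (F x) ∂μ ≤ τ ^ 2 / 4) : ∫ x, |F x - 1| ∂μ ≤ τ := by
  have h1 : Integrable (fun x => F x * Real.log (F x) - F x + 1) μ :=
    (hlog.sub hF).add (integrable_const 1)
  have h0 : Integrable (fun x => F x * Real.log (F x) - F x) μ := hlog.sub hF
  have h2 : Integrable (fun x => F x + 1) μ := hF.add (integrable_const 1)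
  have habs : Integrable (fun x => |F x - 1|) μ := (hF.sub (integrable_const 1)).abs
  have h := integral_mono habs
    ((h1.const_mul (2 / τ)).add (h2.const_mul (τ / 4)))
    fun x => abs_sub_one_le_mul_entropy (hF0 x) hτ
  simp only [Pi.add_apply] at h
  rw [integral_add (h1.const_mul _) (h2.const_mul _), integral_const_mul, integral_const_mul,
    integral_add h0 (integrable_const 1), integral_sub hlog hF,
    integral_add hF (integrable_const 1), hF1] at h
  simp only [integral_const, probReal_univ, smul_eq_mul, mul_one, sub_add_cancel] at h
  have h3 : 2 / τ * ∫ x, F x * Real.log (F x) ∂μ ≤ 2 / τ * (τ ^ 2 / 4) := by gcongr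
  have h4 : 2 / τ * (τ ^ 2 / 4) = τ / 2 := by field_simp; ring
  linarith

lemma integrable_of_integral_min_le {μ : Measure X} [IsFiniteMeasure μ] {v : X → ℝ}
    (hv : Measurable v) (hv0 : ∀ x, 0 ≤ v x) {C : ℝ}
    (h : ∀ k : ℕ, ∫ x, min (v x) k ∂μ ≤ C) :
    Integrable v μ ∧ ∫ x, v x ∂μ ≤ C := by
  have hmin0 : ∀ (k : ℕ) x, 0 ≤ min (v x) k := fun k x => le_min (hv0 x) k.cast_nonneg
  have hint : ∀ k : ℕ, Integrable (fun x => min (v x) k) μ := fun k =>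
    Integrable.of_bound (hv.min measurable_const).aestronglyMeasurable k
      (Filter.Eventually.of_forall fun x => by
        rw [Real.norm_of_nonneg (hmin0 k x)]
        exact min_le_right _ _)
  have hC : 0 ≤ C := (integral_nonneg fun x => hmin0 0 x).trans (h 0)
  have hle : ∫⁻ x, ENNReal.ofReal (v x) ∂μ ≤ ENNReal.ofReal C := by
    have htend := lintegral_tendsto_of_tendsto_of_monotone (μ := μ)
      (f := fun (k : ℕ) x => ENNReal.ofReal (min (v x) k)) (F := fun x => ENNReal.ofReal (v x))
      (fun k => (hv.min measurable_const).ennreal_ofReal.aemeasurable)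
      (Filter.Eventually.of_forall fun x i j hij => ENNReal.ofReal_le_ofReal
        (min_le_min_left _ (Nat.cast_le.2 hij)))
      (Filter.Eventually.of_forall fun x => by
        obtain ⟨N, hN⟩ := exists_nat_ge (v x)
        refine tendsto_const_nhds.congr' ?_
        filter_upwards [Filter.eventually_ge_atTop N] with k hk
        rw [min_eq_left (hN.trans (Nat.cast_le.2 hk))])
    refine le_of_tendsto' htend fun k => ?_
    rw [← ofReal_integral_eq_lintegral_ofReal (hint k) (Filter.Eventually.of_forall (hmin0 k))]
    exact ENNReal.ofReal_le_ofReal (h k)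
  have hvint : Integrable v μ := by
    refine ⟨hv.aestronglyMeasurable, ?_⟩
    rw [hasFiniteIntegral_iff_ofReal (Filter.Eventually.of_forall hv0)]
    exact hle.trans_lt ENNReal.ofReal_lt_top
  refine ⟨hvint, ?_⟩
  rw [← ENNReal.ofReal_le_ofReal_iff hC,
    ofReal_integral_eq_lintegral_ofReal hvint (Filter.Eventually.of_forall hv0)]
  exact hle

lemma exists_integral_mul_le {μ : Measure X} [IsFiniteMeasure μ] {v : X → ℝ}
    (hv : Integrable v μ) {δ : ℝ} (hδ : 0 < δ) :
    ∃ R : ℝ, 0 ≤ R ∧ ∀ κ : X → ℝ, Measurable κ → (∀ x, 0 ≤ κ x) → (∀ x, κ x ≤ 1) →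
      ∫ x, κ x * v x ∂μ ≤ δ + R * ∫ x, κ x ∂μ := by
  have hlim : Filter.Tendsto (fun k : ℕ => ∫ x, max (v x - k) 0 ∂μ) Filter.atTop
      (nhds (∫ _, (0 : ℝ) ∂μ)) := by
    refine tendsto_integral_of_dominated_convergence (fun x => |v x|)
      (fun k => ((hv.sub (integrable_const _)).sup (integrable_const 0)).aestronglyMeasurable)
      hv.abs (fun k => Filter.Eventually.of_forall fun x => ?_)
      (Filter.Eventually.of_forall fun x => ?_)
    · have h1 := le_abs_self (v x)
      have h2 : (0 : ℝ) ≤ k := k.cast_nonneg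
      rw [Real.norm_of_nonneg (le_max_right _ _)]
      exact max_le (by linarith) (abs_nonneg _)
    · obtain ⟨N, hN⟩ := exists_nat_ge (v x)
      refine tendsto_const_nhds.congr' ?_
      filter_upwards [Filter.eventually_ge_atTop N] with k hk
      have : (N : ℝ) ≤ k := Nat.cast_le.2 hk
      rw [max_eq_right (by linarith)]
  rw [integral_zero] at hlim
  obtain ⟨k, hk⟩ := (hlim.eventually (gt_mem_nhds hδ)).exists
  refine ⟨k, k.cast_nonneg, fun κ hκ hκ0 hκ1 => ?_⟩
  have hκint : Integrable κ μ := Integrable.of_bound hκ.aestronglyMeasurable 1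
    (Filter.Eventually.of_forall fun x => by
      rw [Real.norm_of_nonneg (hκ0 x)]
      exact hκ1 x)
  have hmax : Integrable (fun x => max (v x - k) 0) μ :=
    (hv.sub (integrable_const _)).sup (integrable_const 0)
  have hκv : Integrable (fun x => κ x * v x) μ :=
    hv.bdd_mul hκ.aestronglyMeasurable (c := 1) (Filter.Eventually.of_forall fun x => by
      rw [Real.norm_of_nonneg (hκ0 x)]
      exact hκ1 x)
  have h := integral_mono hκv (hmax.add (hκint.const_mul (k : ℝ))) fun x => ?_
  · simp only [Pi.add_apply] at h
    rw [integral_add hmax (hκint.const_mul _), integral_const_mul] at h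
    linarith
  · simp only [Pi.add_apply]
    have h1 : κ x * (v x - k) ≤ κ x * max (v x - k) 0 :=
      mul_le_mul_of_nonneg_left (le_max_left _ _) (hκ0 x)
    have h2 : κ x * max (v x - k) 0 ≤ max (v x - k) 0 :=
      mul_le_of_le_one_left (le_max_right _ _) (hκ1 x)
    linarith
end

namespace IsTransportDensity
variable {E : Type*} [NormedAddCommGroup E] [MeasurableSpace E] {ι : Type*} [Fintype ι]
  {μ : Measure E}
  {y : ι → E} {p : ι → ℝ} {c : ℝ} {f : ι → E → ℝ}

lemma integrable_sum (h : IsTransportDensity μ y p c f) : Integrable (fun x => ∑ i, f i x) μ :=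
  integrable_finsetSum _ fun i _ => h.integrable i

lemma integral_sum (h : IsTransportDensity μ y p c f) (hp1 : ∑ i, p i = 1) :
    ∫ x, ∑ i, f i x ∂μ = 1 := by
  rw [integral_finsetSum _ fun i _ => h.integrable i, Finset.sum_congr rfl fun i _ =>
    h.integral_eq i, hp1]

lemma sum_nonneg (h : IsTransportDensity μ y p c f) (x : E) : 0 ≤ ∑ i, f i x :=
  Finset.sum_nonneg fun i _ => h.nonneg i x

variable [BorelSpace E] [IsProbabilityMeasure μ]

lemma integral_min_norm_sq_le (h : IsTransportDensity μ y p c f) (hp1 : ∑ i, p i = 1) {Y R : ℝ}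
    (hY : ∀ i, ‖y i‖ ≤ Y) (hR : 0 ≤ R) :
    ∫ x, min (‖x‖ ^ 2) R ∂μ ≤ 2 * c + 2 * Y ^ 2 + R * ∫ x, |(∑ i, f i x) - 1| ∂μ := by
  have hmin : Integrable (fun x : E => min (‖x‖ ^ 2) R) μ :=
    Integrable.of_bound (Continuous.measurable (by fun_prop)).aestronglyMeasurable R
      (Filter.Eventually.of_forall fun x => by
        rw [Real.norm_of_nonneg (le_min (by positivity) hR)]
        exact min_le_right _ _)
  have hcost : Integrable (fun x => ∑ i, ‖x - y i‖ ^ 2 * f i x) μ :=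
    integrable_finsetSum _ fun i _ => h.integrable_cost i
  have habs : Integrable (fun x => |(∑ i, f i x) - 1|) μ :=
    (h.integrable_sum.sub (integrable_const 1)).abs
  have hA : Integrable (fun x => 2 * ∑ i, ‖x - y i‖ ^ 2 * f i x + 2 * Y ^ 2 * ∑ i, f i x) μ :=
    (hcost.const_mul 2).add (h.integrable_sum.const_mul (2 * Y ^ 2))
  have key := integral_mono hmin (hA.add (habs.const_mul R)) fun x => ?_
  · simp only [Pi.add_apply] at key
    rw [integral_add hA (habs.const_mul R), integral_add (hcost.const_mul 2)
      (h.integrable_sum.const_mul _), integral_const_mul, integral_const_mul, integral_const_mul,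
      h.integral_sum hp1, integral_finsetSum _ fun i _ => h.integrable_cost i] at key
    linarith [h.cost_le]
  · simp only [Pi.add_apply]
    set F := ∑ i, f i x with hF
    have hF0 : 0 ≤ F := h.sum_nonneg x
    have h1 : ‖x‖ ^ 2 * F ≤ 2 * ∑ i, ‖x - y i‖ ^ 2 * f i x + 2 * Y ^ 2 * F := by
      rw [hF, Finset.mul_sum, Finset.mul_sum, Finset.mul_sum, ← Finset.sum_add_distrib]
      refine Finset.sum_le_sum fun i _ => ?_
      have h2 : ‖x‖ ≤ ‖x - y i‖ + Y := by
        have := norm_add_le (x - y i) (y i)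
        rw [sub_add_cancel] at this
        linarith [hY i]
      have h3 : ‖x‖ ^ 2 ≤ 2 * ‖x - y i‖ ^ 2 + 2 * Y ^ 2 := by
        have := pow_le_pow_left₀ (norm_nonneg x) h2 2
        nlinarith [sq_nonneg (‖x - y i‖ - Y)]
      have := mul_le_mul_of_nonneg_right h3 (h.nonneg i x)
      linarith
    have h4 : min (‖x‖ ^ 2) R * F ≤ ‖x‖ ^ 2 * F :=
      mul_le_mul_of_nonneg_right (min_le_left _ _) hF0
    have h5 : min (‖x‖ ^ 2) R * (1 - F) ≤ R * |F - 1| := by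
      rw [abs_sub_comm]
      calc _ ≤ min (‖x‖ ^ 2) R * |1 - F| :=
            mul_le_mul_of_nonneg_left (le_abs_self _) (le_min (by positivity) hR)
        _ ≤ _ := mul_le_mul_of_nonneg_right (min_le_right _ _) (abs_nonneg _)
    linarith

/-- Truncating the total density at `1` and filling up the deficit. -/
lemma exists_sum_eq_one (h : IsTransportDensity μ y p c f) (hp1 : ∑ i, p i = 1)
    (hp : ∀ i, 0 < p i) {Y : ℝ} (hY : ∀ i, ‖y i‖ ≤ Y)
    (hμ : Integrable (fun x => ‖x‖ ^ 2) μ) :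
    ∃ κ : E → ℝ, Measurable κ ∧ (∀ x, 0 ≤ κ x) ∧ (∀ x, κ x ≤ 1) ∧
      (∀ x, κ x ≤ |(∑ i, f i x) - 1|) ∧ ∃ h : ι → E → ℝ, (∀ x, ∑ i, h i x = 1) ∧
      IsTransportDensity μ y p (c + ∫ x, κ x * (2 * ‖x‖ ^ 2 + 2 * Y ^ 2) ∂μ) h := by
  have hFm : Measurable fun x => ∑ i, f i x := Finset.measurable_fun_sum _ fun i _ => h.measurable i
  set g : E → ℝ := fun x => (max (∑ i, f i x) 1)⁻¹ with hg
  have hgm : Measurable g := (hFm.max measurable_const).inv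
  have hM1 : ∀ x, 1 ≤ max (∑ i, f i x) 1 := fun x => le_max_right _ _
  have hg0 : ∀ x, 0 ≤ g x := fun x => inv_nonneg.2 (by linarith [hM1 x])
  have hg1 : ∀ x, g x ≤ 1 := fun x => inv_le_one_of_one_le₀ (hM1 x)
  set κ : E → ℝ := fun x => 1 - (∑ i, f i x) * g x with hκ
  have hκm : Measurable κ := measurable_const.sub (hFm.mul hgm)
  have hFg : ∀ x, (∑ i, f i x) * g x = min (∑ i, f i x) 1 := by
    intro x
    rw [hg]
    rcases le_total (∑ i, f i x) 1 with h1 | h1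
    · simp [h1]
    · simp only [max_eq_left h1, min_eq_right h1]
      exact mul_inv_cancel₀ (by linarith)
  have hκ0 : ∀ x, 0 ≤ κ x := fun x => by
    simp only [hκ, hFg]
    linarith [min_le_right (∑ i, f i x) 1]
  have hκ1 : ∀ x, κ x ≤ 1 := fun x => by
    simp only [hκ]
    linarith [mul_nonneg (h.sum_nonneg x) (hg0 x)]
  have hκabs : ∀ x, κ x ≤ |(∑ i, f i x) - 1| := fun x => by
    simp only [hκ, hFg]
    rcases le_total (∑ i, f i x) 1 with h1 | h1
    · rw [min_eq_left h1, abs_sub_comm]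
      exact le_abs_self _
    · rw [min_eq_right h1, sub_self]
      exact abs_nonneg _
  have hκint : Integrable κ μ := Integrable.of_bound hκm.aestronglyMeasurable 1
    (Filter.Eventually.of_forall fun x => by
      rw [Real.norm_of_nonneg (hκ0 x)]
      exact hκ1 x)
  have hgb : ∀ᵐ x ∂μ, ‖g x‖ ≤ 1 := Filter.Eventually.of_forall fun x => by
    rw [Real.norm_of_nonneg (hg0 x)]
    exact hg1 x
  have hfg : ∀ i, Integrable (fun x => f i x * g x) μ := fun i => by
    simpa only [mul_comm] using (h.integrable i).bdd_mul hgm.aestronglyMeasurable hgb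
  set d : ι → ℝ := fun i => p i - ∫ x, f i x * g x ∂μ with hd
  have hd0 : ∀ i, 0 ≤ d i := fun i => by
    rw [hd]
    simp only
    rw [← h.integral_eq i, sub_nonneg]
    exact integral_mono (hfg i) (h.integrable i) fun x =>
      mul_le_of_le_one_right (h.nonneg i x) (hg1 x)
  have hdsum : ∑ i, d i = ∫ x, κ x ∂μ := by
    have hs : Integrable (fun x => (∑ i, f i x) * g x) μ := by
      simp only [Finset.sum_mul]
      exact integrable_finsetSum _ fun i _ => hfg i
    simp only [hd, hκ, Finset.sum_sub_distrib, hp1]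
    rw [integral_sub (integrable_const 1) hs]
    simp only [Finset.sum_mul]
    rw [integral_finsetSum _ fun i _ => hfg i]
    simp
  obtain ⟨θ, hθ0, hθ1, hθ⟩ : ∃ θ : ι → ℝ, (∀ i, 0 ≤ θ i) ∧ ∑ i, θ i = 1 ∧
      ∀ i, θ i * ∫ x, κ x ∂μ = d i := by
    by_cases h0 : ∫ x, κ x ∂μ = 0
    · refine ⟨p, fun i => (hp i).le, hp1, fun i => ?_⟩
      rw [h0] at hdsum
      rw [h0, mul_zero, ((Finset.sum_eq_zero_iff_of_nonneg fun i _ => hd0 i).1 hdsum) i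
        (Finset.mem_univ i)]
    · refine ⟨fun i => d i / ∫ x, κ x ∂μ, fun i => div_nonneg (hd0 i)
        (integral_nonneg hκ0), ?_, fun i => div_mul_cancel₀ _ h0⟩
      rw [← Finset.sum_div, hdsum, div_self h0]
  have hfgc : ∀ i, Integrable (fun x => ‖x - y i‖ ^ 2 * (f i x * g x)) μ := fun i => by
    refine ((h.integrable_cost i).bdd_mul hgm.aestronglyMeasurable hgb).congr
      (Filter.Eventually.of_forall fun x => ?_)
    simp only
    ring
  have hq : ∀ i x, ‖x - y i‖ ^ 2 ≤ 2 * ‖x‖ ^ 2 + 2 * Y ^ 2 := fun i x => by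
    have h2 : ‖x - y i‖ ≤ ‖x‖ + Y := (norm_sub_le _ _).trans (by linarith [hY i])
    have := pow_le_pow_left₀ (norm_nonneg _) h2 2
    nlinarith [sq_nonneg (‖x‖ - Y)]
  have hvκ : Integrable (fun x => κ x * (2 * ‖x‖ ^ 2 + 2 * Y ^ 2)) μ :=
    ((hμ.const_mul 2).add (integrable_const _)).bdd_mul (c := 1) hκm.aestronglyMeasurable
      (Filter.Eventually.of_forall fun x => by
        rw [Real.norm_of_nonneg (hκ0 x)]
        exact hκ1 x)
  have hκc : ∀ i, Integrable (fun x => κ x * ‖x - y i‖ ^ 2) μ := fun i =>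
    hvκ.mono' (hκm.mul (Continuous.measurable (by fun_prop))).aestronglyMeasurable
      (Filter.Eventually.of_forall fun x => by
        rw [Real.norm_of_nonneg (mul_nonneg (hκ0 x) (by positivity))]
        exact mul_le_mul_of_nonneg_left (hq i x) (hκ0 x))
  have hsplit : ∀ i, (fun x => ‖x - y i‖ ^ 2 * (f i x * g x + θ i * κ x)) = fun x =>
      ‖x - y i‖ ^ 2 * (f i x * g x) + θ i * (κ x * ‖x - y i‖ ^ 2) := fun i => by
    ext x
    ring
  refine ⟨κ, hκm, hκ0, hκ1, hκabs, fun i x => f i x * g x + θ i * κ x, fun x => ?_,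
    fun i => ((h.measurable i).mul hgm).add (hκm.const_mul _),
    fun i x => add_nonneg (mul_nonneg (h.nonneg i x) (hg0 x)) (mul_nonneg (hθ0 i) (hκ0 x)),
    fun i => (hfg i).add (hκint.const_mul _), fun i => ?_, fun i => ?_, ?_⟩
  · rw [Finset.sum_add_distrib, ← Finset.sum_mul, ← Finset.sum_mul, hθ1]
    simp only [hκ]
    ring
  · rw [integral_add (hfg i) (hκint.const_mul _), integral_const_mul, hθ i]
    simp only [hd]
    ring
  · rw [hsplit i]
    exact (hfgc i).add ((hκc i).const_mul _)
  · have h1 : ∀ i, ∫ x, ‖x - y i‖ ^ 2 * (f i x * g x + θ i * κ x) ∂μ ≤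
        ∫ x, ‖x - y i‖ ^ 2 * f i x ∂μ +
          θ i * ∫ x, κ x * (2 * ‖x‖ ^ 2 + 2 * Y ^ 2) ∂μ := fun i => by
      rw [hsplit i, integral_add (hfgc i) ((hκc i).const_mul _), integral_const_mul]
      refine add_le_add (integral_mono (hfgc i) (h.integrable_cost i) fun x => ?_)
        (mul_le_mul_of_nonneg_left (integral_mono (hκc i) hvκ fun x => ?_) (hθ0 i))
      · exact mul_le_mul_of_nonneg_left (mul_le_of_le_one_right (h.nonneg i x) (hg1 x))
          (by positivity)
      · exact mul_le_mul_of_nonneg_left (hq i x) (hκ0 x)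
    refine (Finset.sum_le_sum fun i _ => h1 i).trans ?_
    rw [Finset.sum_add_distrib, ← Finset.sum_mul, hθ1, one_mul]
    gcongr
    exact h.cost_le

/-- Transport densities of total density close to `1` can be corrected to have total density `1`
at almost no cost. -/
theorem exists_of_entropy_le (hp1 : ∑ i, p i = 1) (hp : ∀ i, 0 < p i)
    (hf : ∀ η : ℝ, 0 < η → ∃ f, IsTransportDensity μ y p c f ∧
      Integrable (fun x => (∑ i, f i x) * Real.log (∑ i, f i x)) μ ∧
      ∫ x, (∑ i, f i x) * Real.log (∑ i, f i x) ∂μ ≤ η) :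
    Integrable (fun x => ‖x‖ ^ 2) μ ∧ ∀ δ : ℝ, 0 < δ →
      ∃ h, (∀ x, ∑ i, h i x = 1) ∧ IsTransportDensity μ y p (c + δ) h := by
  have hfτ : ∀ τ : ℝ, 0 < τ → ∃ f, IsTransportDensity μ y p c f ∧
      ∫ x, |(∑ i, f i x) - 1| ∂μ ≤ τ := by
    intro τ hτ
    obtain ⟨f, hf1, hf2, hf3⟩ := hf (τ ^ 2 / 4) (by positivity)
    exact ⟨f, hf1, integral_abs_sub_one_le hf1.sum_nonneg hf1.integrable_sum
      (hf1.integral_sum hp1) hf2 hτ hf3⟩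
  obtain ⟨Y, hY⟩ : ∃ Y, ∀ i, ‖y i‖ ≤ Y := ⟨∑ i, ‖y i‖, fun i =>
    Finset.single_le_sum (f := fun i => ‖y i‖) (fun _ _ => norm_nonneg _) (Finset.mem_univ i)⟩
  have hμ : Integrable (fun x => ‖x‖ ^ 2) μ := by
    refine (integrable_of_integral_min_le (C := 2 * c + 2 * Y ^ 2 + 1)
      (Continuous.measurable (by fun_prop)) (fun x => by positivity) fun k => ?_).1
    obtain ⟨f, hf1, hf2⟩ := hfτ (1 / (k + 1)) (by positivity)
    have h1 := hf1.integral_min_norm_sq_le hp1 hY (R := k) k.cast_nonneg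
    have h2 : (k : ℝ) * ∫ x, |(∑ i, f i x) - 1| ∂μ ≤ k * (1 / (k + 1)) := by gcongr
    have h3 : (k : ℝ) * (1 / (k + 1)) ≤ 1 := by
      rw [mul_one_div, div_le_one (by positivity)]
      linarith
    linarith
  refine ⟨hμ, fun δ hδ => ?_⟩
  obtain ⟨R, hR, hRκ⟩ := exists_integral_mul_le
    ((hμ.const_mul 2).add (integrable_const (2 * Y ^ 2))) (half_pos hδ)
  obtain ⟨f, hf1, hf2⟩ := hfτ (δ / 2 / (R + 1)) (by positivity)
  obtain ⟨κ, hκm, hκ0, hκ1, hκabs, h, hh1, hh⟩ := hf1.exists_sum_eq_one hp1 hp hY hμ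
  refine ⟨h, hh1, hh.measurable, hh.nonneg, hh.integrable, hh.integral_eq, hh.integrable_cost,
    hh.cost_le.trans ?_⟩
  have h1 := hRκ κ hκm hκ0 hκ1
  have h2 : ∫ x, κ x ∂μ ≤ δ / 2 / (R + 1) :=
    (integral_mono_of_nonneg (Filter.Eventually.of_forall hκ0)
      (hf1.integrable_sum.sub (integrable_const 1)).abs
      (Filter.Eventually.of_forall hκabs)).trans hf2
  have h3 : R * ∫ x, κ x ∂μ ≤ R * (δ / 2 / (R + 1)) := by gcongr
  have h4 : R * (δ / 2 / (R + 1)) ≤ δ / 2 := by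
    rw [← mul_div_assoc, div_le_iff₀ (by positivity)]
    nlinarith
  simp only [Pi.add_apply] at h1
  linarith

end IsTransportDensity

/-- The variational form of the bound `H(ν | μ) ≤ H`. -/
def EntropyDualBound {X : Type*} [TopologicalSpace X] [MeasurableSpace X] (μ ν : Measure X)
    (H : ℝ) : Prop :=
  ∀ G : X → ℝ, Continuous G → (∃ M, ∀ x, |G x| ≤ M) →
    ∫ x, G x ∂ν ≤ ∫ x, Real.exp (G x) ∂μ - 1 + H

lemma integral_comp_eq_sum {X ι : Type*} [MeasurableSpace X] [Fintype ι] {ν : Measure X}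
    [IsFiniteMeasure ν] {k : X → ι} (hk : ∀ i, MeasurableSet (k ⁻¹' {i})) (m : ι → ℝ) :
    Integrable (fun x => m (k x)) ν ∧
      ∫ x, m (k x) ∂ν = ∑ i, ν.real (k ⁻¹' {i}) * m i := by
  have h1 : (fun x => m (k x)) = fun x => ∑ i, (k ⁻¹' {i}).indicator (fun _ => m i) x := by
    ext x
    rw [Finset.sum_eq_single (k x)]
    · simp
    · intro i _ hi
      exact Set.indicator_of_notMem (fun h => hi (by simpa using h.symm)) _
    · simp
  have h2 : ∀ i ∈ Finset.univ, Integrable ((k ⁻¹' {i}).indicator fun _ => m i) ν := fun i _ =>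
    (integrable_const _).indicator (hk i)
  rw [h1]
  refine ⟨integrable_finsetSum _ h2, ?_⟩
  rw [integral_finsetSum _ h2]
  refine Finset.sum_congr rfl fun i _ => ?_
  rw [integral_indicator_const _ (hk i), smul_eq_mul]

section Coupling
variable {E : Type*} [NormedAddCommGroup E] [MeasurableSpace E] [BorelSpace E]
  {ι : Type*} [Fintype ι] {μ ν : Measure E} [IsProbabilityMeasure μ]
  [IsProbabilityMeasure ν]

lemma dualFun_le_of_entropyDualBound [Nonempty ι] {H : ℝ} (hν : EntropyDualBound μ ν H) {k : E → ι}
    (hk : ∀ i, MeasurableSet (k ⁻¹' {i})) {y : ι → E}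
    (hint : Integrable (fun x => ‖x - y (k x)‖ ^ 2) ν) {ε : ℝ} (hε : 0 < ε) (m : ι → ℝ) {s : ℝ}
    (hs : 0 ≤ s) :
    dualFun μ y (fun i => ν.real (k ⁻¹' {i})) ε m s ≤
      H + s * ((∫ x, ‖x - y (k x)‖ ^ 2 ∂ν) / 2) := by
  obtain ⟨C, hC⟩ := exists_softExp_quadProfile_le y hε m hs
  set F : E → ℝ := fun x => softExp ε (quadProfile y m s x) with hF
  have hFpos : ∀ x, 0 < F x := fun x => softExp_pos _ _
  have hFc : Continuous F := (continuous_softExp ε).comp (continuous_quadProfile_right y m s)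
  have hFint : Integrable F μ := integrable_softExp μ y hε m hs
  obtain ⟨hm1, hm2⟩ := integral_comp_eq_sum (ν := ν) hk m
  have key : ∀ K : ℕ, ∑ i, ν.real (k ⁻¹' {i}) * m i - s * ((∫ x, ‖x - y (k x)‖ ^ 2 ∂ν) / 2) ≤
      ∫ x, F x ∂μ + Real.exp (-K) - 1 + H := by
    intro K
    have hGc : Continuous fun x => max (Real.log (F x)) (-(K : ℝ)) :=
      (hFc.log fun x => (hFpos x).ne').max continuous_const
    have hGb : ∀ x, |max (Real.log (F x)) (-(K : ℝ))| ≤ |Real.log C| + K := by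
      intro x
      have h1 : Real.log (F x) ≤ |Real.log C| :=
        (Real.log_le_log (hFpos x) (hC x)).trans (le_abs_self _)
      have h2 : (0 : ℝ) ≤ K := K.cast_nonneg
      have h3 := abs_nonneg (Real.log C)
      rw [abs_le]
      exact ⟨by linarith [le_max_right (Real.log (F x)) (-(K : ℝ))],
        max_le (by linarith) (by linarith)⟩
    have hGint : Integrable (fun x => max (Real.log (F x)) (-(K : ℝ))) ν :=
      Integrable.of_bound hGc.measurable.aestronglyMeasurable _ (Filter.Eventually.of_forall hGb)
    have hG := hν _ hGc ⟨_, hGb⟩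
    have h1 : ∫ x, Real.exp (max (Real.log (F x)) (-(K : ℝ))) ∂μ ≤
        ∫ x, F x ∂μ + Real.exp (-K) := by
      have h2 := integral_mono_of_nonneg (μ := μ)
        (f := fun x => Real.exp (max (Real.log (F x)) (-(K : ℝ))))
        (g := fun x => F x + Real.exp (-K))
        (Filter.Eventually.of_forall fun x => (Real.exp_pos _).le)
        (hFint.add (integrable_const _)) (Filter.Eventually.of_forall fun x => by
          rcases max_choice (Real.log (F x)) (-(K : ℝ)) with h | h
          · simp only [h, Real.exp_log (hFpos x)]
            linarith [Real.exp_pos (-(K : ℝ))]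
          · simp only [h]
            linarith [hFpos x])
      rw [integral_add hFint (integrable_const _)] at h2
      simpa using h2
    have h3 : ∫ x, (m (k x) - s / 2 * ‖x - y (k x)‖ ^ 2) ∂ν ≤
        ∫ x, max (Real.log (F x)) (-(K : ℝ)) ∂ν := by
      refine integral_mono (hm1.sub (hint.const_mul _)) hGint fun x => ?_
      refine le_trans ?_ (le_max_left _ _)
      rw [Real.le_log_iff_exp_le (hFpos x)]
      refine le_trans (Real.exp_le_exp.2 (le_of_eq ?_)) (exp_le_softExp hε _ (k x))
      simp only [quadProfile]
      ring
    rw [integral_sub hm1 (hint.const_mul _), hm2, integral_const_mul] at h3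
    linarith
  have hlim : Filter.Tendsto (fun K : ℕ => ∫ x, F x ∂μ + Real.exp (-(K : ℝ)) - 1 + H)
      Filter.atTop (nhds (∫ x, F x ∂μ + 0 - 1 + H)) :=
    (((Real.tendsto_exp_neg_atTop_nhds_zero.comp tendsto_natCast_atTop_atTop).const_add
      (∫ x, F x ∂μ)).sub_const 1).add_const H
  have := ge_of_tendsto' hlim key
  unfold dualFun
  linarith

variable [SecondCountableTopology E]

lemma exists_coupling_of_isTransportDensity {k : E → ι} (hk : ∀ i, MeasurableSet (k ⁻¹' {i}))
    (hpos : ∀ i, 0 < ν.real (k ⁻¹' {i})) {y : ι → E}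
    (hint : Integrable (fun x => ‖x - y (k x)‖ ^ 2) ν) {c : ℝ} {h : ι → E → ℝ}
    (h1 : ∀ x, ∑ i, h i x = 1)
    (hh : IsTransportDensity μ y (fun i => ν.real (k ⁻¹' {i})) c h) {lam : ℝ} (hlam : 0 < lam) :
    ∃ π : Measure (E × E), π.map Prod.fst = ν ∧ π.map Prod.snd = μ ∧
      ∫⁻ q, ENNReal.ofReal (‖q.1 - q.2‖ ^ 2) ∂π ≤
        ENNReal.ofReal ((1 + 1 / lam) * ∫ x, ‖x - y (k x)‖ ^ 2 ∂ν + (1 + lam) * c) := by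
  set p : ι → ℝ≥0∞ := fun i => ν (k ⁻¹' {i}) with hp
  have hpr : ∀ i, p i = ENNReal.ofReal (ν.real (k ⁻¹' {i})) := fun i => by
    rw [ofReal_measureReal]
  have hp0 : ∀ i, p i ≠ 0 := fun i => by
    rw [hpr]
    exact (ENNReal.ofReal_pos.2 (hpos i)).ne'
  have hpt : ∀ i, p i ≠ ∞ := fun i => measure_ne_top _ _
  set μi : ι → Measure E := fun i => μ.withDensity fun x => ENNReal.ofReal (h i x) with hμi
  have hμi1 : ∀ i, μi i Set.univ = p i := fun i => by
    rw [hμi, hpr, ← hh.integral_eq i, ofReal_integral_eq_lintegral_ofReal (hh.integrable i)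
      (Filter.Eventually.of_forall (hh.nonneg i))]
    simp
  have hfin : ∀ i, IsFiniteMeasure (μi i) := fun i =>
    ⟨by rw [hμi1]; exact (hpt i).lt_top⟩
  set νi : ι → Measure E := fun i => ν.restrict (k ⁻¹' {i}) with hνi
  have hνi1 : ∀ i, νi i Set.univ = p i := fun i => by simp [hνi, hp]
  have hνsum : ∑ i, νi i = ν := by
    rw [hνi, ← Measure.sum_fintype, ← Measure.restrict_iUnion _ hk]
    · rw [← Set.preimage_iUnion, Set.iUnion_of_singleton, Set.preimage_univ, Measure.restrict_univ]
    · intro i j hij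
      exact Disjoint.preimage _ (by simpa using hij)
  have hμsum : ∑ i, μi i = μ := by
    ext s hs
    simp only [hμi, Measure.coe_finsetSum, Finset.sum_apply, withDensity_apply _ hs]
    rw [← lintegral_finsetSum _ fun i _ => (hh.measurable i).ennreal_ofReal]
    have : ∀ x, ∑ i, ENNReal.ofReal (h i x) = 1 := fun x => by
      rw [← ENNReal.ofReal_sum_of_nonneg fun i _ => hh.nonneg i x, h1, ENNReal.ofReal_one]
    simp [this]
  set π : Measure (E × E) := ∑ i, (p i)⁻¹ • (νi i).prod (μi i) with hπ
  have hπfst : π.map Prod.fst = ν := by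
    rw [hπ, Measure.map_finset_sum measurable_fst.aemeasurable]
    conv_rhs => rw [← hνsum]
    refine Finset.sum_congr rfl fun i _ => ?_
    rw [Measure.map_smul, Measure.map_fst_prod, hμi1, smul_smul,
      ENNReal.inv_mul_cancel (hp0 i) (hpt i), one_smul]
  have hπsnd : π.map Prod.snd = μ := by
    rw [hπ, Measure.map_finset_sum measurable_snd.aemeasurable]
    conv_rhs => rw [← hμsum]
    refine Finset.sum_congr rfl fun i _ => ?_
    rw [Measure.map_smul, Measure.map_snd_prod, hνi1, smul_smul,
      ENNReal.inv_mul_cancel (hp0 i) (hpt i), one_smul]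
  refine ⟨π, hπfst, hπsnd, ?_⟩
  have hbound : ∀ i, (p i)⁻¹ * ∫⁻ q, ENNReal.ofReal (‖q.1 - q.2‖ ^ 2) ∂(νi i).prod (μi i) ≤
      ENNReal.ofReal (1 + 1 / lam) * ∫⁻ x in k ⁻¹' {i}, ENNReal.ofReal (‖x - y (k x)‖ ^ 2) ∂ν +
        ENNReal.ofReal (1 + lam) * ENNReal.ofReal (∫ x, ‖x - y i‖ ^ 2 * h i x ∂μ) := by
    intro i
    have hm1 : Measurable fun x : E => ENNReal.ofReal (‖x - y i‖ ^ 2) :=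
      (Continuous.measurable (by fun_prop)).ennreal_ofReal
    have hmf : Measurable fun q : E × E => ENNReal.ofReal (‖q.1 - y i‖ ^ 2) :=
      hm1.comp measurable_fst
    have hms : Measurable fun q : E × E => ENNReal.ofReal (‖q.2 - y i‖ ^ 2) :=
      hm1.comp measurable_snd
    have e1 : ∫⁻ q, ENNReal.ofReal (‖q.1 - y i‖ ^ 2) ∂(νi i).prod (μi i) =
        p i * ∫⁻ x in k ⁻¹' {i}, ENNReal.ofReal (‖x - y (k x)‖ ^ 2) ∂ν := by
      rw [← lintegral_map hm1 measurable_fst, Measure.map_fst_prod, hμi1, lintegral_smul_measure,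
        smul_eq_mul]
      congr 1
      refine setLIntegral_congr_fun (hk i) fun x hx => ?_
      have hx : k x = i := hx
      simp only [hx]
    have e2 : ∫⁻ q, ENNReal.ofReal (‖q.2 - y i‖ ^ 2) ∂(νi i).prod (μi i) =
        p i * ENNReal.ofReal (∫ x, ‖x - y i‖ ^ 2 * h i x ∂μ) := by
      rw [← lintegral_map hm1 measurable_snd, Measure.map_snd_prod, hνi1, lintegral_smul_measure,
        smul_eq_mul]
      congr 1
      rw [lintegral_withDensity_eq_lintegral_mul _ (hh.measurable i).ennreal_ofReal hm1,
        ofReal_integral_eq_lintegral_ofReal (hh.integrable_cost i)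
          (Filter.Eventually.of_forall fun x => mul_nonneg (by positivity) (hh.nonneg i x))]
      refine lintegral_congr fun x => ?_
      rw [Pi.mul_apply, ENNReal.ofReal_mul (by positivity), mul_comm]
    have e3 : ∫⁻ q, ENNReal.ofReal (‖q.1 - q.2‖ ^ 2) ∂(νi i).prod (μi i) ≤
        ENNReal.ofReal (1 + 1 / lam) * (p i *
          ∫⁻ x in k ⁻¹' {i}, ENNReal.ofReal (‖x - y (k x)‖ ^ 2) ∂ν) +
        ENNReal.ofReal (1 + lam) * (p i * ENNReal.ofReal (∫ x, ‖x - y i‖ ^ 2 * h i x ∂μ)) := by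
      rw [← e1, ← e2, ← lintegral_const_mul _ hmf, ← lintegral_const_mul _ hms,
        ← lintegral_add_left (hmf.const_mul _)]
      refine lintegral_mono fun q => ?_
      rw [← ENNReal.ofReal_mul (by positivity), ← ENNReal.ofReal_mul (by positivity),
        ← ENNReal.ofReal_add (by positivity) (by positivity)]
      refine ENNReal.ofReal_le_ofReal ?_
      have t1 : ‖q.1 - q.2‖ ≤ ‖q.1 - y i‖ + ‖q.2 - y i‖ := by
        rw [← sub_sub_sub_cancel_right q.1 q.2 (y i)]
        exact norm_sub_le _ _
      have t2 := pow_le_pow_left₀ (norm_nonneg _) t1 2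
      have t3 : (1 + 1 / lam) * ‖q.1 - y i‖ ^ 2 + (1 + lam) * ‖q.2 - y i‖ ^ 2 -
          (‖q.1 - y i‖ + ‖q.2 - y i‖) ^ 2 =
          1 / lam * (‖q.1 - y i‖ - lam * ‖q.2 - y i‖) ^ 2 := by
        field_simp
        ring
      have t4 : 0 ≤ 1 / lam * (‖q.1 - y i‖ - lam * ‖q.2 - y i‖) ^ 2 := by positivity
      linarith
    calc _ ≤ (p i)⁻¹ * _ := mul_le_mul_right e3 _
      _ = (p i)⁻¹ * p i * (ENNReal.ofReal (1 + 1 / lam) *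
          ∫⁻ x in k ⁻¹' {i}, ENNReal.ofReal (‖x - y (k x)‖ ^ 2) ∂ν +
        ENNReal.ofReal (1 + lam) * ENNReal.ofReal (∫ x, ‖x - y i‖ ^ 2 * h i x ∂μ)) := by ring
      _ = _ := by rw [ENNReal.inv_mul_cancel (hp0 i) (hpt i), one_mul]
  rw [hπ, lintegral_finsetSum_measure]
  simp only [lintegral_smul_measure, smul_eq_mul]
  refine (Finset.sum_le_sum fun i _ => hbound i).trans ?_
  rw [Finset.sum_add_distrib, ← Finset.mul_sum, ← Finset.mul_sum, ← lintegral_finsetSum_measure,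
    hνsum, ← ENNReal.ofReal_sum_of_nonneg fun i _ => integral_nonneg fun x =>
      mul_nonneg (by positivity) (hh.nonneg i x),
    ← ofReal_integral_eq_lintegral_ofReal hint (Filter.Eventually.of_forall fun x => by positivity),
    ← ENNReal.ofReal_mul (by positivity), ← ENNReal.ofReal_mul (by positivity),
    ← ENNReal.ofReal_add (mul_nonneg (by positivity) (integral_nonneg fun x => by positivity))
      (mul_nonneg (by positivity) (Finset.sum_nonneg fun i _ => integral_nonneg fun x =>
        mul_nonneg (by positivity) (hh.nonneg i x)))]
  refine ENNReal.ofReal_le_ofReal ?_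
  gcongr
  exact hh.cost_le

end Coupling

section Transport
variable {E : Type*} [NormedAddCommGroup E] [MeasurableSpace E] [BorelSpace E]

lemma exists_quantization [SecondCountableTopology E] {ν : Measure E} [IsProbabilityMeasure ν]
    (hν : Integrable (fun x => ‖x‖ ^ 2) ν) {D : ℝ} (hD : 0 < D) :
    ∃ (s : Finset E) (k : E → s), (∀ i, MeasurableSet (k ⁻¹' {i})) ∧
      (∀ i, 0 < ν.real (k ⁻¹' {i})) ∧ Integrable (fun x => ‖x - k x‖ ^ 2) ν ∧
      ∫ x, ‖x - k x‖ ^ 2 ∂ν ≤ D := by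
  have hid : MemLp (id : E → E) 2 ν :=
    (memLp_two_iff_integrable_sq_norm aestronglyMeasurable_id).2 hν
  obtain ⟨T, hT, hT2⟩ := hid.exists_simpleFunc_eLpNorm_sub_lt (by simp)
    (ε := ENNReal.ofReal (Real.sqrt D)) (by simpa using hD)
  set s : Finset E := T.range.filter fun v => ν (T ⁻¹' {v}) ≠ 0 with hs
  have hae : ∀ᵐ x ∂ν, T x ∈ s := by
    rw [ae_iff]
    have : {x | T x ∉ s} ⊆ ⋃ v ∈ T.range.filter fun v => ν (T ⁻¹' {v}) = 0, T ⁻¹' {v} := by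
      intro x hx
      simp only [hs, Set.mem_ofPred_eq, Finset.mem_filter, SimpleFunc.mem_range_self, true_and,
        not_not] at hx
      simp only [Set.mem_iUnion]
      exact ⟨T x, by simpa using hx, rfl⟩
    refine measure_mono_null this ((measure_biUnion_null_iff (Finset.countable_toSet _)).2 ?_)
    intro v hv
    exact (Finset.mem_filter.1 hv).2
  obtain ⟨x₀, hx₀⟩ := hae.exists
  set kk : E → s := fun v => if h : v ∈ s then ⟨v, h⟩ else ⟨T x₀, hx₀⟩ with hkk
  have hk : ∀ᵐ x ∂ν, ‖x - kk (T x)‖ ^ 2 = ‖((id : E → E) - ⇑T) x‖ ^ 2 := by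
    filter_upwards [hae] with x hx
    simp [hkk, hx]
  have hmem : MemLp (id - ⇑T) 2 ν := hid.sub hT2
  have hint : Integrable (fun x => ‖((id : E → E) - ⇑T) x‖ ^ 2) ν :=
    (memLp_two_iff_integrable_sq_norm hmem.1).1 hmem
  refine ⟨s, fun x => kk (T x), fun i => T.measurableSet_preimage (kk ⁻¹' {i}), fun i => ?_,
    hint.congr (hk.mono fun x hx => hx.symm), ?_⟩
  · rw [measureReal_def, ENNReal.toReal_pos_iff]
    refine ⟨?_, measure_lt_top _ _⟩
    have h1 : T ⁻¹' {(i : E)} ⊆ (fun x => kk (T x)) ⁻¹' {i} := by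
      intro x hx
      have hx : T x = i := hx
      simp [hkk, hx]
    exact (pos_iff_ne_zero.2 (Finset.mem_filter.1 i.2).2).trans_le (measure_mono h1)
  · rw [integral_congr_ae hk]
    have h1 : eLpNorm (id - ⇑T) 2 ν =
        ENNReal.ofReal ((∫ x, ‖((id : E → E) - ⇑T) x‖ ^ 2 ∂ν) ^ (1 / 2 : ℝ)) := by
      rw [hmem.eLpNorm_eq_integral_rpow_norm (by simp) (by simp)]
      simp
    rw [h1, ENNReal.ofReal_lt_ofReal_iff (Real.sqrt_pos.2 hD), ← Real.sqrt_eq_rpow] at hT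
    exact ((Real.sqrt_lt_sqrt_iff (integral_nonneg fun x => by positivity)).1 hT).le

lemma integral_norm_sq_le_of_coupling [SecondCountableTopology E] {μ ν : Measure E}
    {π : Measure (E × E)} (h1 : π.map Prod.fst = ν)
    (h2 : π.map Prod.snd = μ) {C : ℝ} (hC : 0 ≤ C)
    (hπ : ∫⁻ q, ENNReal.ofReal (‖q.1 - q.2‖ ^ 2) ∂π ≤ ENNReal.ofReal C)
    (hμ : Integrable (fun x => ‖x‖ ^ 2) μ) :
    ∫ x, ‖x‖ ^ 2 ∂ν ≤ 2 * C + 2 * ∫ x, ‖x‖ ^ 2 ∂μ := by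
  have hm : Measurable fun x : E => ENNReal.ofReal (‖x‖ ^ 2) :=
    (Continuous.measurable (by fun_prop)).ennreal_ofReal
  have hm2 : Measurable fun q : E × E => ENNReal.ofReal (‖q.1 - q.2‖ ^ 2) :=
    (Continuous.measurable (by fun_prop)).ennreal_ofReal
  have hms : Measurable fun q : E × E => ENNReal.ofReal (‖q.2‖ ^ 2) := hm.comp measurable_snd
  have h0 : 0 ≤ ∫ x, ‖x‖ ^ 2 ∂μ := integral_nonneg fun x => by positivity
  rw [integral_eq_lintegral_of_nonneg_ae (Filter.Eventually.of_forall fun x => by positivity)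
    (Continuous.aestronglyMeasurable (by fun_prop))]
  refine ENNReal.toReal_le_of_le_ofReal (by positivity) ?_
  rw [← h1, lintegral_map hm measurable_fst, ENNReal.ofReal_add (by positivity) (by positivity),
    ENNReal.ofReal_mul (by norm_num), ENNReal.ofReal_mul (by norm_num),
    ofReal_integral_eq_lintegral_ofReal hμ (Filter.Eventually.of_forall fun x => by positivity),
    ← h2, lintegral_map hm measurable_snd]
  refine le_trans ?_ (add_le_add_left (mul_le_mul_right hπ _) _)
  rw [← lintegral_const_mul _ hm2, ← lintegral_const_mul _ hms,
    ← lintegral_add_left (hm2.const_mul _)]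
  refine lintegral_mono fun q => ?_
  rw [← ENNReal.ofReal_mul (by norm_num), ← ENNReal.ofReal_mul (by norm_num),
    ← ENNReal.ofReal_add (by positivity) (by positivity)]
  refine ENNReal.ofReal_le_ofReal ?_
  have h3 : ‖q.1‖ ≤ ‖q.1 - q.2‖ + ‖q.2‖ := by
    simpa using norm_add_le (q.1 - q.2) q.2
  have h4 := pow_le_pow_left₀ (norm_nonneg _) h3 2
  nlinarith [sq_nonneg (‖q.1 - q.2‖ - ‖q.2‖)]

end Transport

section Talagrand
variable {E : Type*} [NormedAddCommGroup E] [InnerProductSpace ℝ E] [MeasurableSpace E]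
  [BorelSpace E] [SecondCountableTopology E] {μ ν : Measure E} [IsProbabilityMeasure μ]
  [IsProbabilityMeasure ν] {β : ℝ → ℝ}

/-- The transport inequality `W₂(ν, μ) ≤ γ(H(ν | μ))`, when `ν` has a finite second moment. -/
theorem BetaLogSobolev.exists_coupling (hLSI : BetaLogSobolev β μ) (hβ : IsAdmissibleRate β)
    {H : ℝ} (hH : 0 ≤ H) (hνH : EntropyDualBound μ ν H) (hν : Integrable (fun x => ‖x‖ ^ 2) ν)
    {δ : ℝ} (hδ : 0 < δ) :
    Integrable (fun x => ‖x‖ ^ 2) μ ∧ ∃ π : Measure (E × E), π.map Prod.fst = ν ∧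
      π.map Prod.snd = μ ∧ ∫⁻ q, ENNReal.ofReal (‖q.1 - q.2‖ ^ 2) ∂π ≤
        ENNReal.ofReal ((halfInvSqrtIntegral β H + δ) ^ 2) := by
  set r := halfInvSqrtIntegral β H with hr
  have hr0 : 0 ≤ r := hβ.nonneg hH
  set a := δ / 4 with ha
  set b := r + δ / 2 with hb
  set κ := (r + δ) ^ 2 - b ^ 2 with hκ
  have hκ0 : 0 < κ := by
    have : κ = δ / 2 * (2 * r + 3 / 2 * δ) := by rw [hκ, hb]; ring
    rw [this]; positivity
  set lam := κ / 4 / (b ^ 2 + κ / 4) with hlam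
  have hlam0 : 0 < lam := by positivity
  set D := min (a ^ 2 / 2) (κ / 4 / (1 + 1 / lam)) with hD
  have hD0 : 0 < D := lt_min (by positivity) (by positivity)
  obtain ⟨s, k, hk, hpos, hint, hle⟩ := exists_quantization hν hD0
  have : Nonempty s := ⟨k 0⟩
  have hp1 : ∑ i, ν.real (k ⁻¹' {i}) = 1 := by
    have := (integral_comp_eq_sum (ν := ν) hk fun _ => 1).2
    simpa using this.symm
  obtain ⟨hμ, hδh⟩ := IsTransportDensity.exists_of_entropy_le (μ := μ)
    (y := fun i : s => (i : E)) (c := b ^ 2) hp1 hpos fun η hη => by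
      set K : ℝ := Fintype.card s - 1 + b ^ 2 / 2 with hK
      have hε0 : 0 < min 1 (η / (|K| + 1)) := lt_min one_pos (by positivity)
      obtain ⟨f, hf1, hf2, hf3⟩ := exists_isTransportDensity_entropy_le (y := fun i : s => (i : E))
        hβ hLSI hpos hp1 hε0 (min_le_left _ _) hH (w₀ := (∫ x, ‖x - k x‖ ^ 2 ∂ν) / 2)
        (a := a) (b := b) (by positivity)
        (fun m t ht => dualFun_le_of_entropyDualBound hνH hk hint hε0 m ht) (by positivity)
        (by
          have : D ≤ a ^ 2 / 2 := min_le_left _ _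
          have : 0 < a ^ 2 := by positivity
          linarith) (by rw [← hr, hb, ha]; linarith)
      refine ⟨f, hf1, hf2, hf3.trans ?_⟩
      calc min 1 (η / (|K| + 1)) * K ≤ η / (|K| + 1) * (|K| + 1) :=
            mul_le_mul (min_le_right _ _) (by linarith [le_abs_self K]) ?_ (by positivity)
        _ = η := by field_simp
      rw [hK]
      have : (1 : ℝ) ≤ Fintype.card s := by exact_mod_cast Fintype.card_pos
      have : 0 ≤ b ^ 2 := by positivity
      linarith
  refine ⟨hμ, ?_⟩
  obtain ⟨h, h1, hh⟩ := hδh (κ / 4) (by positivity)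
  obtain ⟨π, hπ1, hπ2, hπ3⟩ := exists_coupling_of_isTransportDensity hk hpos hint h1 hh hlam0
  refine ⟨π, hπ1, hπ2, hπ3.trans (ENNReal.ofReal_le_ofReal ?_)⟩
  have e1 : (1 + 1 / lam) * ∫ x, ‖x - k x‖ ^ 2 ∂ν ≤ κ / 4 := by
    have := hle.trans (min_le_right _ _)
    rwa [le_div_iff₀' (by positivity)] at this
  have e2 : lam * (b ^ 2 + κ / 4) = κ / 4 := by
    rw [hlam]
    field_simp
  linarith

end Talagrand

section Mollify
variable {E : Type*} [NormedAddCommGroup E] [NormedSpace ℝ E] [FiniteDimensional ℝ E]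
  [MeasurableSpace E] [BorelSpace E] {vol : Measure E} [vol.IsAddHaarMeasure]

lemma enorm_fderiv_convolution_le {ρ u : E → ℝ} (hρ : ContDiff ℝ 1 ρ) (hρc : HasCompactSupport ρ)
    (hu : Differentiable ℝ u) (huc : HasCompactSupport u) (hDu : Integrable (fderiv ℝ u) vol)
    (x : E) :
    ‖fderiv ℝ (convolution ρ u (ContinuousLinearMap.lsmul ℝ ℝ) vol) x‖ₑ ≤
      ∫⁻ t, ‖ρ t‖ₑ * ‖fderiv ℝ u (x - t)‖ₑ ∂vol := by
  have hui : Integrable u vol := hu.continuous.integrable_of_hasCompactSupport huc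
  have hD := hρc.hasFDerivAt_convolution_left (ContinuousLinearMap.lsmul ℝ ℝ) hρ
    hui.locallyIntegrable x
  rw [hD.fderiv]
  obtain ⟨C, hC⟩ := hρ.continuous.bounded_above_of_compact_support hρc
  have hDx : Integrable (fun t => fderiv ℝ u (x - t)) vol := hDu.comp_sub_left x
  have hρD : Integrable (fun t => ‖ρ t‖ * ‖fderiv ℝ u (x - t)‖) vol :=
    hDx.norm.bdd_mul (c := C) hρ.continuous.norm.aestronglyMeasurable
      (Filter.Eventually.of_forall fun t => by simpa using hC t)
  have hnn : 0 ≤ ∫ t, ‖ρ t‖ * ‖fderiv ℝ u (x - t)‖ ∂vol := integral_nonneg fun t => by positivity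
  have hle : ‖(convolution (fderiv ℝ ρ) u ((ContinuousLinearMap.lsmul ℝ ℝ).precompL E) vol) x‖ ≤
      ∫ t, ‖ρ t‖ * ‖fderiv ℝ u (x - t)‖ ∂vol := by
    refine ContinuousLinearMap.opNorm_le_bound _ hnn fun v => ?_
    have hex := (hρc.fderiv (𝕜 := ℝ)).convolutionExists_left
      ((ContinuousLinearMap.lsmul ℝ ℝ).precompL E) (hρ.continuous_fderiv one_ne_zero)
      hui.locallyIntegrable (μ := vol) x
    have e1 : (convolution (fderiv ℝ ρ) u ((ContinuousLinearMap.lsmul ℝ ℝ).precompL E) vol) x v =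
        ∫ t, fderiv ℝ ρ t v * u (x - t) ∂vol := by
      rw [convolution, ContinuousLinearMap.integral_apply hex]
      rfl
    have e2 : ∀ t, fderiv ℝ (fun t => u (x - t)) t v = -(fderiv ℝ u (x - t) v) := fun t => by
      have h1 : HasFDerivAt (fun t => u (x - t)) ((fderiv ℝ u (x - t)).comp
          (-ContinuousLinearMap.id ℝ E)) t :=
        (hu (x - t)).hasFDerivAt.comp t ((hasFDerivAt_id t).const_sub x)
      rw [h1.fderiv]
      simp
    have hbd : ∀ t, ‖ρ t * fderiv ℝ u (x - t) v‖ ≤ ‖ρ t‖ * ‖fderiv ℝ u (x - t)‖ * ‖v‖ := by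
      intro t
      rw [norm_mul, mul_assoc]
      exact mul_le_mul_of_nonneg_left (ContinuousLinearMap.le_opNorm _ _) (norm_nonneg _)
    have i1 : Integrable (fun t => ρ t * fderiv ℝ u (x - t) v) vol :=
      (hρD.mul_const ‖v‖).mono' (hρ.continuous.aestronglyMeasurable.mul
        (hDx.aestronglyMeasurable.apply_continuousLinearMap v)) (Filter.Eventually.of_forall hbd)
    have hcx : Continuous fun t => u (x - t) := hu.continuous.comp (by fun_prop)
    have hdv : Continuous fun t => fderiv ℝ ρ t v :=
      (hρ.continuous_fderiv one_ne_zero).clm_apply continuous_const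
    have ibp := integral_mul_fderiv_eq_neg_fderiv_mul_of_integrable (μ := vol) (f := ρ)
      (g := fun t => u (x - t)) (v := v)
      ((hdv.mul hcx).integrable_of_hasCompactSupport
        ((hρc.fderiv_apply (𝕜 := ℝ) v).mul_right))
      (by simpa only [e2, mul_neg] using i1.fun_neg)
      ((hρ.continuous.mul hcx).integrable_of_hasCompactSupport hρc.mul_right)
      (fun t _ => (hρ.differentiable one_ne_zero) t)
      (fun t _ => (hu (x - t)).comp t (by fun_prop))
    simp only [e2, mul_neg, integral_neg, neg_inj] at ibp
    rw [e1, ← ibp, ← integral_mul_const]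
    exact norm_integral_le_of_norm_le (hρD.mul_const _) (Filter.Eventually.of_forall hbd)
  rw [← ofReal_norm]
  refine (ENNReal.ofReal_le_ofReal hle).trans (le_of_eq ?_)
  rw [ofReal_integral_eq_lintegral_ofReal hρD (Filter.Eventually.of_forall fun t => by positivity)]
  refine lintegral_congr fun t => ?_
  rw [ENNReal.ofReal_mul (norm_nonneg _), ofReal_norm, ofReal_norm]

lemma sq_lintegral_mul_le {X : Type*} [MeasurableSpace X] {P : Measure X} {ρ f : X → ℝ≥0∞}
    (hρ : Measurable ρ) (hf : Measurable f) (hρ1 : ∫⁻ t, ρ t ∂P = 1) :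
    (∫⁻ t, ρ t * f t ∂P) ^ 2 ≤ ∫⁻ t, ρ t * f t ^ 2 ∂P := by
  have h := ENNReal.lintegral_mul_le_Lp_mul_Lq (P.withDensity ρ) Real.HolderConjugate.two_two
    (f := fun _ => 1) (g := f) aemeasurable_const hf.aemeasurable
  simp only [Pi.mul_apply, one_mul, ENNReal.rpow_two, one_pow, lintegral_one] at h
  rw [lintegral_withDensity_eq_lintegral_mul _ hρ hf,
    lintegral_withDensity_eq_lintegral_mul _ hρ (hf.pow_const 2), withDensity_apply _ .univ,
    Measure.restrict_univ, hρ1, ENNReal.one_rpow, one_mul] at h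
  have h2 := pow_le_pow_left' h 2
  rw [← ENNReal.rpow_two ((∫⁻ t, (ρ * fun x => f x ^ 2) t ∂P) ^ _), ← ENNReal.rpow_mul] at h2
  simpa using h2

lemma lintegral_enorm_fderiv_convolution_sq_le {ρ u w : E → ℝ} (hρ : ContDiff ℝ 1 ρ)
    (hρc : HasCompactSupport ρ) (hρ0 : ∀ x, 0 ≤ ρ x) (hρ1 : ∫ x, ρ x ∂vol = 1)
    (hu : Differentiable ℝ u) (huc : HasCompactSupport u) (hDu : Integrable (fderiv ℝ u) vol)
    (hw : Measurable w) {A : ℝ} (hA : 0 ≤ A)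
    (hwA : ∀ z ∈ tsupport u, ∀ t ∈ tsupport ρ, w (z + t) ≤ A * w z) :
    ∫⁻ x, ‖fderiv ℝ (convolution ρ u (ContinuousLinearMap.lsmul ℝ ℝ) vol) x‖ₑ ^ 2 *
        ENNReal.ofReal (w x) ∂vol ≤
      ENNReal.ofReal A * ∫⁻ x, ‖fderiv ℝ u x‖ₑ ^ 2 * ENNReal.ofReal (w x) ∂vol := by
  have hρm : Measurable fun t => ‖ρ t‖ₑ := hρ.continuous.measurable.enorm
  have hDm : Measurable fun x => ‖fderiv ℝ u x‖ₑ := (measurable_fderiv ℝ u).enorm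
  have hρ1' : ∫⁻ t, ‖ρ t‖ₑ ∂vol = 1 := by
    have h1 : ∀ t, ‖ρ t‖ₑ = ENNReal.ofReal (ρ t) := fun t => Real.enorm_of_nonneg (hρ0 t)
    simp only [h1]
    rw [← ofReal_integral_eq_lintegral_ofReal
      (hρ.continuous.integrable_of_hasCompactSupport hρc) (Filter.Eventually.of_forall hρ0), hρ1,
      ENNReal.ofReal_one]
  calc _ ≤ ∫⁻ x, ∫⁻ t, ‖ρ t‖ₑ * ‖fderiv ℝ u (x - t)‖ₑ ^ 2 * ENNReal.ofReal (w x) ∂vol ∂vol := by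
        refine lintegral_mono fun x => ?_
        have hm : Measurable fun t => ‖fderiv ℝ u (x - t)‖ₑ :=
          hDm.comp (measurable_const.sub measurable_id)
        have hm2 : Measurable fun t => ‖ρ t‖ₑ * ‖fderiv ℝ u (x - t)‖ₑ ^ 2 :=
          hρm.mul (hm.pow_const 2)
        rw [lintegral_mul_const _ hm2]
        gcongr
        exact (pow_le_pow_left' (enorm_fderiv_convolution_le hρ hρc hu huc hDu x) 2).trans
          (sq_lintegral_mul_le hρm hm hρ1')
    _ = ∫⁻ t, ∫⁻ x, ‖ρ t‖ₑ * ‖fderiv ℝ u (x - t)‖ₑ ^ 2 * ENNReal.ofReal (w x) ∂vol ∂vol := by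
        refine lintegral_lintegral_swap (Measurable.aemeasurable ?_)
        exact ((hρm.comp measurable_snd).mul ((hDm.comp (measurable_fst.sub
          measurable_snd)).pow_const 2)).mul (hw.ennreal_ofReal.comp measurable_fst)
    _ = ∫⁻ t, ∫⁻ z, ‖ρ t‖ₑ * ‖fderiv ℝ u z‖ₑ ^ 2 * ENNReal.ofReal (w (z + t)) ∂vol ∂vol := by
        refine lintegral_congr fun t => ?_
        rw [← lintegral_sub_right_eq_self
          (fun z => ‖ρ t‖ₑ * ‖fderiv ℝ u z‖ₑ ^ 2 * ENNReal.ofReal (w (z + t))) t]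
        simp
    _ ≤ ∫⁻ t, ∫⁻ z, ‖ρ t‖ₑ * (ENNReal.ofReal A * (‖fderiv ℝ u z‖ₑ ^ 2 *
          ENNReal.ofReal (w z))) ∂vol ∂vol := by
        refine lintegral_mono fun t => lintegral_mono fun z => ?_
        by_cases ht : t ∈ tsupport ρ
        · by_cases hz : z ∈ tsupport u
          · have := ENNReal.ofReal_le_ofReal (hwA z hz t ht)
            rw [ENNReal.ofReal_mul hA] at this
            calc _ ≤ ‖ρ t‖ₑ * ‖fderiv ℝ u z‖ₑ ^ 2 * (ENNReal.ofReal A * ENNReal.ofReal (w z)) := by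
                  gcongr
              _ = _ := by ring
          · have h0 : fderiv ℝ u z = 0 := by
              by_contra h
              exact hz (support_fderiv_subset ℝ h)
            have h1 : ‖fderiv ℝ u z‖ₑ = 0 := by rw [← ofReal_norm, h0, norm_zero, ofReal_zero]
            simp [h1]
        · simp [image_eq_zero_of_notMem_tsupport ht]
    _ = _ := by
        have hm : Measurable fun z => ‖fderiv ℝ u z‖ₑ ^ 2 * ENNReal.ofReal (w z) :=
          (hDm.pow_const 2).mul hw.ennreal_ofReal
        simp only [lintegral_const_mul _ (hm.const_mul _), lintegral_const_mul _ hm]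
        rw [lintegral_mul_const _ hρm, hρ1', one_mul]

end Mollify

section Approximation
variable {E : Type*} [NormedAddCommGroup E]

lemma HasCompactSupport.exists_convolution_radius {u w : E → ℝ} (hu : Continuous u)
    (huc : HasCompactSupport u) (hw : Continuous w) (hw0 : ∀ x, 0 < w x) {A τ : ℝ} (hA : 1 < A)
    (hτ : 0 < τ) :
    ∃ ε : ℝ, 0 < ε ∧ (∀ z ∈ tsupport u, ∀ t, ‖t‖ < ε → w (z + t) ≤ A * w z) ∧
      ∀ x y, dist x y < ε → dist (u x) (u y) ≤ τ := by
  obtain ⟨ε₁, hε₁, h1⟩ := Metric.uniformContinuous_iff.1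
    (huc.uniformContinuous_of_continuous hu) τ hτ
  have h2 := huc.isCompact.uniformContinuousAt_of_continuousAt (fun x => Real.log (w x))
    (fun x _ => (hw.log fun x => (hw0 x).ne').continuousAt)
    (Metric.dist_mem_uniformity (Real.log_pos hA))
  obtain ⟨ε₂, hε₂, h2⟩ := Metric.mem_uniformity_dist.1 h2
  refine ⟨min ε₁ ε₂, lt_min hε₁ hε₂, fun z hz t ht => ?_,
    fun x y hxy => (h1 (hxy.trans_le (min_le_left _ _))).le⟩
  have h3 := h2 (a := z) (b := z + t)
    (by simpa [dist_eq_norm] using ht.trans_le (min_le_right _ _)) hz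
  have h4 : dist (Real.log (w z)) (Real.log (w (z + t))) < Real.log A := h3
  rw [Real.dist_eq, abs_lt] at h4
  rw [← Real.log_le_log_iff (hw0 _) (mul_pos (by linarith) (hw0 z)),
    Real.log_mul (by linarith) (hw0 z).ne']
  linarith [h4.1]

variable [NormedSpace ℝ E] [MeasurableSpace E] [BorelSpace E]

lemma integrable_fderiv_of_lintegral_lt_top [FiniteDimensional ℝ E] {vol : Measure E}
    [vol.IsAddHaarMeasure] {w u : E → ℝ} (hw : Continuous w)
    (hw0 : ∀ x, 0 < w x) (huc : HasCompactSupport u)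
    (hJ : ∫⁻ x, ‖fderiv ℝ u x‖ₑ ^ 2 * ENNReal.ofReal (w x) ∂vol < ∞) :
    Integrable (fderiv ℝ u) vol := by
  refine ⟨(measurable_fderiv ℝ u).aestronglyMeasurable, ?_⟩
  obtain ⟨C, hC⟩ := huc.isCompact.exists_bound_of_continuousOn (f := fun x => (w x)⁻¹)
    (hw.inv₀ fun x => (hw0 x).ne').continuousOn
  have hm : Measurable fun x => ‖fderiv ℝ u x‖ₑ ^ 2 * ENNReal.ofReal (w x) :=
    ((measurable_fderiv ℝ u).enorm.pow_const 2).mul hw.measurable.ennreal_ofReal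
  calc ∫⁻ x, ‖fderiv ℝ u x‖ₑ ∂vol ≤ ∫⁻ x, ((tsupport u).indicator 1 x +
        ENNReal.ofReal C * (‖fderiv ℝ u x‖ₑ ^ 2 * ENNReal.ofReal (w x))) ∂vol := by
        refine lintegral_mono fun x => ?_
        by_cases hx : x ∈ tsupport u
        · have h1 : 1 ≤ C * w x := by
            have := (le_abs_self _).trans (hC x hx)
            rwa [inv_le_iff_one_le_mul₀ (hw0 x)] at this
          have h2 : ‖fderiv ℝ u x‖ ≤ 1 + C * (‖fderiv ℝ u x‖ ^ 2 * w x) := by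
            have h3 := sq_nonneg (‖fderiv ℝ u x‖ - 1)
            have h4 := mul_le_mul_of_nonneg_right h1 (sq_nonneg ‖fderiv ℝ u x‖)
            nlinarith
          have hC0 : 0 ≤ C := (norm_nonneg _).trans (hC x hx)
          rw [Set.indicator_of_mem hx, Pi.one_apply, ← ofReal_norm,
            ← ENNReal.ofReal_pow (norm_nonneg _), ← ENNReal.ofReal_mul (by positivity),
            ← ENNReal.ofReal_mul hC0, ← ENNReal.ofReal_one,
            ← ENNReal.ofReal_add zero_le_one (mul_nonneg hC0 (mul_nonneg (by positivity)
              (hw0 x).le))]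
          exact ENNReal.ofReal_le_ofReal h2
        · have h0 : fderiv ℝ u x = 0 := by
            by_contra h
            exact hx (support_fderiv_subset ℝ h)
          rw [← ofReal_norm, h0, norm_zero, ofReal_zero]
          exact zero_le
    _ = vol (tsupport u) + ENNReal.ofReal C *
          ∫⁻ x, ‖fderiv ℝ u x‖ₑ ^ 2 * ENNReal.ofReal (w x) ∂vol := by
        rw [lintegral_add_left (measurable_one.indicator (isClosed_tsupport u).measurableSet),
          lintegral_const_mul _ hm, lintegral_indicator_one (isClosed_tsupport u).measurableSet]
    _ < ∞ := ENNReal.add_lt_top.2 ⟨huc.isCompact.measure_lt_top,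
        ENNReal.mul_lt_top ENNReal.ofReal_lt_top hJ⟩

lemma lintegral_fderiv_sq_withDensity {vol : Measure E} {w u : E → ℝ} (hw : Continuous w) :
    ∫⁻ x, ‖fderiv ℝ u x‖ₑ ^ 2 ∂vol.withDensity (fun x => ENNReal.ofReal (w x)) =
      ∫⁻ x, ‖fderiv ℝ u x‖ₑ ^ 2 * ENNReal.ofReal (w x) ∂vol := by
  rw [lintegral_withDensity_eq_lintegral_mul _ hw.measurable.ennreal_ofReal
    ((measurable_fderiv ℝ u).enorm.pow_const 2)]
  refine lintegral_congr fun x => ?_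
  rw [Pi.mul_apply, mul_comm]

lemma exists_contDiff_approx [FiniteDimensional ℝ E] {vol : Measure E}
    [vol.IsAddHaarMeasure] {w u : E → ℝ} (hw : Continuous w) (hw0 : ∀ x, 0 < w x) {μ : Measure E}
    [IsProbabilityMeasure μ] (hμ : μ = vol.withDensity fun x => ENNReal.ofReal (w x))
    (hu : Differentiable ℝ u) (huc : HasCompactSupport u) {B : ℝ≥0∞}
    (hJ : ∫⁻ x, ‖fderiv ℝ u x‖ₑ ^ 2 ∂μ < B) {δ : ℝ} (hδ : 0 < δ) :
    ∃ φ : E → ℝ, ContDiff ℝ 1 φ ∧ HasCompactSupport φ ∧ ∫ x, |φ x ^ 2 - u x ^ 2| ∂μ ≤ δ ∧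
      ∫⁻ x, ‖fderiv ℝ φ x‖ₑ ^ 2 ∂μ < B := by
  obtain ⟨A, hA, hA1⟩ : ∃ A : ℝ, ENNReal.ofReal A * ∫⁻ x, ‖fderiv ℝ u x‖ₑ ^ 2 ∂μ < B ∧ 1 < A := by
    have h1 : Filter.Tendsto (fun A : ℝ => ENNReal.ofReal A * ∫⁻ x, ‖fderiv ℝ u x‖ₑ ^ 2 ∂μ)
        (nhds 1) (nhds (ENNReal.ofReal 1 * ∫⁻ x, ‖fderiv ℝ u x‖ₑ ^ 2 ∂μ)) :=
      ENNReal.Tendsto.mul_const (ENNReal.continuous_ofReal.tendsto 1) (Or.inr hJ.ne_top)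
    rw [ENNReal.ofReal_one, one_mul] at h1
    exact (((h1.eventually_lt_const hJ).filter_mono nhdsWithin_le_nhds).and
      (self_mem_nhdsWithin (s := Set.Ioi (1 : ℝ)))).exists
  obtain ⟨M, hM⟩ := hu.continuous.bounded_above_of_compact_support huc
  have hM0 : 0 ≤ M := (norm_nonneg _).trans (hM 0)
  set τ := min 1 (δ / (2 * M + 1)) with hτ
  have hτ0 : 0 < τ := lt_min one_pos (by positivity)
  obtain ⟨ε, hε, hε1, hε2⟩ := huc.exists_convolution_radius hu.continuous hw hw0 hA1 hτ0
  let ψ : ContDiffBump (0 : E) := ⟨ε / 4, ε / 2, by positivity, by linarith⟩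
  have hui : Integrable u vol := hu.continuous.integrable_of_hasCompactSupport huc
  have hφ : ContDiff ℝ 1 (convolution (ψ.normed vol) u (ContinuousLinearMap.lsmul ℝ ℝ) vol) :=
    ψ.hasCompactSupport_normed.contDiff_convolution_left (n := 1) _ ψ.contDiff_normed
      hui.locallyIntegrable
  refine ⟨_, hφ, ψ.hasCompactSupport_normed.convolution _ huc, ?_, ?_⟩
  · have hd : ∀ x, |convolution (ψ.normed vol) u (ContinuousLinearMap.lsmul ℝ ℝ) vol x ^ 2 -
        u x ^ 2| ≤ δ := by
      intro x
      have h1 := ψ.dist_normed_convolution_le (μ := vol) (x₀ := x) (ε := τ)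
        hui.aestronglyMeasurable fun y hy => hε2 y x (by
          have : dist y x < ε / 2 := hy
          linarith)
      rw [Real.dist_eq] at h1
      set c := convolution (ψ.normed vol) u (ContinuousLinearMap.lsmul ℝ ℝ) vol x
      have h2 : |c + u x| ≤ 2 * M + 1 := by
        have h3 : |c + u x| ≤ |c - u x| + 2 * |u x| := by
          have : c + u x = (c - u x) + 2 * u x := by ring
          rw [this]
          refine (abs_add_le _ _).trans (le_of_eq ?_)
          rw [abs_mul, abs_two]
        have h4 : |u x| ≤ M := hM x
        have h5 : τ ≤ 1 := min_le_left _ _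
        linarith
      have h6 : c ^ 2 - u x ^ 2 = (c - u x) * (c + u x) := by ring
      rw [h6, abs_mul]
      calc _ ≤ δ / (2 * M + 1) * (2 * M + 1) := by
            gcongr
            exact h1.trans (min_le_right _ _)
        _ = δ := by field_simp
    refine (integral_mono_of_nonneg (Filter.Eventually.of_forall fun x => abs_nonneg _)
      (integrable_const δ) (Filter.Eventually.of_forall hd)).trans (le_of_eq ?_)
    simp
  · refine lt_of_le_of_lt ?_ hA
    rw [hμ, lintegral_fderiv_sq_withDensity hw] at hJ
    rw [hμ, lintegral_fderiv_sq_withDensity hw, lintegral_fderiv_sq_withDensity hw]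
    refine lintegral_enorm_fderiv_convolution_sq_le ψ.contDiff_normed ψ.hasCompactSupport_normed
      ψ.nonneg_normed ψ.integral_normed hu huc
      (integrable_fderiv_of_lintegral_lt_top hw hw0 huc (hJ.trans_le le_top)) hw.measurable
      (by linarith) fun z hz t ht => hε1 z hz t ?_
    rw [ψ.tsupport_normed_eq, mem_closedBall_zero_iff] at ht
    have : ‖t‖ ≤ ε / 2 := ht
    linarith

end Approximation

section Cutoff
variable {E : Type*} [NormedAddCommGroup E] [NormedSpace ℝ E] [FiniteDimensional ℝ E]

/-- The cutoffs `x ↦ χ (x / (k + 1))` with `χ = 1` on the unit ball and `χ = 0` outside of the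
ball of radius `2`. -/
lemma exists_cutoff : ∃ (C : ℝ) (χ : ℕ → E → ℝ), 0 ≤ C ∧ ∀ k, Differentiable ℝ (χ k) ∧
    HasCompactSupport (χ k) ∧ (∀ x, 0 ≤ χ k x ∧ χ k x ≤ 1) ∧ (∀ x, ‖x‖ < k + 1 → χ k x = 1) ∧
    ∀ x, ‖fderiv ℝ (χ k) x‖ ≤ C := by
  let ψ : ContDiffBump (0 : E) := ⟨1, 2, one_pos, one_lt_two⟩
  have hψ : ContDiff ℝ 1 ψ := ψ.contDiff
  obtain ⟨C, hC⟩ := (hψ.continuous_fderiv one_ne_zero).bounded_above_of_compact_support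
    (ψ.hasCompactSupport.fderiv (𝕜 := ℝ))
  have hC0 : 0 ≤ C := (norm_nonneg _).trans (hC 0)
  refine ⟨C, fun k x => ψ ((k + 1 : ℝ)⁻¹ • x), hC0, fun k => ?_⟩
  have hk : (0 : ℝ) < k + 1 := by positivity
  have hd : ∀ x, HasFDerivAt (fun x => ψ ((k + 1 : ℝ)⁻¹ • x))
      ((fderiv ℝ ψ ((k + 1 : ℝ)⁻¹ • x)).comp ((k + 1 : ℝ)⁻¹ • ContinuousLinearMap.id ℝ E)) x :=
    fun x => ((hψ.differentiable one_ne_zero) _).hasFDerivAt.comp x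
      ((hasFDerivAt_id x).const_smul ((k + 1 : ℝ)⁻¹))
  refine ⟨fun x => (hd x).differentiableAt, ?_, fun x => ⟨ψ.nonneg, ψ.le_one⟩, fun x hx => ?_,
    fun x => ?_⟩
  · exact ψ.hasCompactSupport.comp_smul (inv_pos.2 hk).ne'
  · refine ψ.one_of_mem_closedBall ?_
    rw [mem_closedBall_zero_iff, norm_smul, norm_inv, Real.norm_of_nonneg hk.le]
    exact (inv_mul_le_one₀ hk).2 hx.le
  · rw [(hd x).fderiv]
    refine (ContinuousLinearMap.opNorm_comp_le _ _).trans ?_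
    refine (mul_le_mul (hC _) ?_ (norm_nonneg _) hC0).trans (mul_one C).le
    refine (norm_smul_le (k + 1 : ℝ)⁻¹ (ContinuousLinearMap.id ℝ E)).trans ?_
    rw [norm_inv, Real.norm_of_nonneg hk.le]
    refine mul_le_one₀ (inv_le_one_of_one_le₀ ?_) (norm_nonneg _) ContinuousLinearMap.norm_id_le
    linarith [(k.cast_nonneg : (0 : ℝ) ≤ k)]

variable [MeasurableSpace E] [BorelSpace E] {μ : Measure E} {g : E → ℝ} {B : ℝ≥0∞}

lemma exists_hasCompactSupport_approx (hg : Differentiable ℝ g)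
    (hg2 : Integrable (fun x => g x ^ 2) μ) (hJ : ∫⁻ x, ‖fderiv ℝ g x‖ₑ ^ 2 ∂μ < B) {δ : ℝ}
    (hδ : 0 < δ) :
    ∃ u : E → ℝ, Differentiable ℝ u ∧ HasCompactSupport u ∧ Integrable (fun x => u x ^ 2) μ ∧
      ∫ x, |u x ^ 2 - g x ^ 2| ∂μ ≤ δ ∧ ∫⁻ x, ‖fderiv ℝ u x‖ₑ ^ 2 ∂μ < B := by
  obtain ⟨C, χ, hC0, hχ⟩ := exists_cutoff (E := E)
  choose hχd hχc hχ01 hχ1 hχC using hχ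
  have hev : ∀ x : E, ∀ᶠ k : ℕ in Filter.atTop, ‖x‖ < k + 1 := fun x => by
    obtain ⟨N, hN⟩ := exists_nat_gt ‖x‖
    filter_upwards [Filter.eventually_ge_atTop N] with k hk
    have : (N : ℝ) ≤ k := by exact_mod_cast hk
    linarith
  have hsq : ∀ L : E →L[ℝ] ℝ, ‖L‖ₑ ^ 2 = ENNReal.ofReal (‖L‖ ^ 2) := fun L => by
    rw [← ofReal_norm, ENNReal.ofReal_pow (norm_nonneg _)]
  have hd : ∀ k, Differentiable ℝ fun x => χ k x * g x := fun k => (hχd k).mul hg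
  have hle : ∀ k x, (χ k x * g x) ^ 2 ≤ g x ^ 2 := fun k x => by
    rw [mul_pow]
    exact mul_le_of_le_one_left (sq_nonneg _) (pow_le_one₀ (hχ01 k x).1 (hχ01 k x).2)
  have hD : Filter.Tendsto (fun k => ∫⁻ x, ‖fderiv ℝ (fun x => χ k x * g x) x‖ₑ ^ 2 ∂μ)
      Filter.atTop (nhds (∫⁻ x, ‖fderiv ℝ g x‖ₑ ^ 2 ∂μ)) := by
    refine tendsto_lintegral_of_dominated_convergence
      (fun x => 2 * ‖fderiv ℝ g x‖ₑ ^ 2 + ENNReal.ofReal (2 * C ^ 2 * g x ^ 2))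
      (fun k => (measurable_fderiv ℝ _).enorm.pow_const 2)
      (fun k => Filter.Eventually.of_forall fun x => ?_) ?_
      (Filter.Eventually.of_forall fun x => ?_)
    · have h1 : fderiv ℝ (fun x => χ k x * g x) x = χ k x • fderiv ℝ g x + g x • fderiv ℝ (χ k) x :=
        fderiv_fun_mul (hχd k x) (hg x)
      have h2 : ‖fderiv ℝ (fun x => χ k x * g x) x‖ ≤ ‖fderiv ℝ g x‖ + |g x| * C := by
        rw [h1]
        refine (norm_add_le _ _).trans (add_le_add ?_ ?_)
        · rw [norm_smul, Real.norm_of_nonneg (hχ01 k x).1]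
          exact mul_le_of_le_one_left (norm_nonneg _) (hχ01 k x).2
        · rw [norm_smul, Real.norm_eq_abs]
          exact mul_le_mul_of_nonneg_left (hχC k x) (abs_nonneg _)
      have h3 := pow_le_pow_left₀ (norm_nonneg _) h2 2
      have h4 : ‖fderiv ℝ (fun x => χ k x * g x) x‖ ^ 2 ≤
          2 * ‖fderiv ℝ g x‖ ^ 2 + 2 * C ^ 2 * g x ^ 2 := by
        nlinarith [sq_nonneg (‖fderiv ℝ g x‖ - |g x| * C), sq_abs (g x)]
      simp only [hsq]
      refine (ENNReal.ofReal_le_ofReal h4).trans (le_of_eq ?_)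
      rw [ENNReal.ofReal_add (by positivity) (by positivity), ENNReal.ofReal_mul zero_le_two,
        ENNReal.ofReal_ofNat]
    · have hm : Measurable fun x => ‖fderiv ℝ g x‖ₑ ^ 2 := (measurable_fderiv ℝ g).enorm.pow_const 2
      rw [lintegral_add_left (hm.const_mul 2), lintegral_const_mul _ hm]
      exact (ENNReal.add_lt_top.2 ⟨ENNReal.mul_lt_top (by simp) (hJ.trans_le le_top),
        (hg2.const_mul _).lintegral_lt_top⟩).ne
    · refine tendsto_const_nhds.congr' ?_
      filter_upwards [hev x] with k hk
      have h1 : (fun x => χ k x * g x) =ᶠ[nhds x] g := by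
        filter_upwards [(isOpen_lt continuous_norm continuous_const).mem_nhds hk] with y hy
        rw [hχ1 k y hy, one_mul]
      rw [h1.fderiv_eq]
  have hI : Filter.Tendsto (fun k => ∫ x, |(χ k x * g x) ^ 2 - g x ^ 2| ∂μ)
      Filter.atTop (nhds (∫ _, 0 ∂μ)) := by
    refine tendsto_integral_of_dominated_convergence (fun x => g x ^ 2)
      (fun k => Continuous.aestronglyMeasurable
        ((((hd k).continuous.pow 2).sub (hg.continuous.pow 2)).abs)) hg2
      (fun k => Filter.Eventually.of_forall fun x => ?_) (Filter.Eventually.of_forall fun x => ?_)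
    · rw [Real.norm_eq_abs, abs_abs, abs_sub_comm, abs_of_nonneg (sub_nonneg.2 (hle k x))]
      linarith [sq_nonneg (χ k x * g x)]
    · refine tendsto_const_nhds.congr' ?_
      filter_upwards [hev x] with k hk
      simp [hχ1 k x hk]
  rw [integral_zero] at hI
  obtain ⟨k, h1, h2⟩ := ((hD.eventually_lt_const hJ).and (hI.eventually_le_const hδ)).exists
  exact ⟨_, hd k, (hχc k).mul_right, hg2.mono' (Continuous.aestronglyMeasurable
    ((hd k).continuous.pow 2)) (Filter.Eventually.of_forall fun x => by
      rw [Real.norm_of_nonneg (sq_nonneg _)]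
      exact hle k x), h2, h1⟩

lemma exists_contDiff_approx_integral_eq_one {vol : Measure E} [vol.IsAddHaarMeasure] {w : E → ℝ}
    (hw : Continuous w) (hw0 : ∀ x, 0 < w x) [IsProbabilityMeasure μ]
    (hμ : μ = vol.withDensity fun x => ENNReal.ofReal (w x)) (hg : Differentiable ℝ g)
    (hg1 : ∫ x, g x ^ 2 ∂μ = 1) {b : ℝ} (hJ : ∫⁻ x, ‖fderiv ℝ g x‖ₑ ^ 2 ∂μ < ENNReal.ofReal b)
    {δ : ℝ} (hδ : 0 < δ) :
    ∃ φ : E → ℝ, ContDiff ℝ 1 φ ∧ HasCompactSupport φ ∧ ∫ x, φ x ^ 2 ∂μ = 1 ∧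
      ∫ x, |φ x ^ 2 - g x ^ 2| ∂μ ≤ δ ∧ ∫⁻ x, ‖fderiv ℝ φ x‖ₑ ^ 2 ∂μ ≤ ENNReal.ofReal b := by
  obtain ⟨b', hb', hJ', hbb'⟩ := ENNReal.lt_iff_exists_real_btwn.1 hJ
  obtain ⟨hb0, hbb'⟩ := (ENNReal.ofReal_lt_ofReal_iff_of_nonneg hb').1 hbb' |> fun h =>
    And.intro (hb'.trans_lt h) h
  set η := min (min (1 / 4) (δ / 4)) ((b - b') / (2 * b)) with hη
  have hη0 : 0 < η := lt_min (lt_min (by norm_num) (by positivity))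
    (div_pos (by linarith) (by positivity))
  have hη1 : η ≤ 1 / 4 := (min_le_left _ _).trans (min_le_left _ _)
  have hη2 : η ≤ δ / 4 := (min_le_left _ _).trans (min_le_right _ _)
  have hη3 : η * (2 * b) ≤ b - b' := (le_div_iff₀ (by positivity)).1 (min_le_right _ _)
  have hg2 : Integrable (fun x => g x ^ 2) μ := by
    by_contra h
    rw [integral_undef h] at hg1
    exact zero_ne_one hg1
  obtain ⟨u, hu, huc, hu2, hug, huJ⟩ := exists_hasCompactSupport_approx hg hg2 hJ' hη0
  obtain ⟨φ, hφ, hφc, hφu, hφJ⟩ := exists_contDiff_approx hw hw0 hμ hu huc huJ hη0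
  have hφ2 : Integrable (fun x => φ x ^ 2) μ := by
    obtain ⟨M, hM⟩ := hφ.continuous.bounded_above_of_compact_support hφc
    refine Integrable.of_bound (Continuous.aestronglyMeasurable (hφ.continuous.pow 2)) (M ^ 2)
      (Filter.Eventually.of_forall fun x => ?_)
    rw [norm_pow]
    exact pow_le_pow_left₀ (norm_nonneg _) (hM x) 2
  have i1 : Integrable (fun x => |φ x ^ 2 - u x ^ 2|) μ := (hφ2.sub hu2).abs
  have i2 : Integrable (fun x => |u x ^ 2 - g x ^ 2|) μ := (hu2.sub hg2).abs
  have i3 : Integrable (fun x => |φ x ^ 2 - g x ^ 2|) μ := (hφ2.sub hg2).abs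
  have hφg : ∫ x, |φ x ^ 2 - g x ^ 2| ∂μ ≤ 2 * η := by
    have h1 : ∫ x, |φ x ^ 2 - g x ^ 2| ∂μ ≤ ∫ x, (|φ x ^ 2 - u x ^ 2| + |u x ^ 2 - g x ^ 2|) ∂μ :=
      integral_mono i3 (i1.add i2) fun x => abs_sub_le _ _ _
    rw [integral_add i1 i2] at h1
    linarith
  set m := ∫ x, φ x ^ 2 ∂μ with hm
  have hm1 : |m - 1| ≤ 2 * η := by
    rw [hm, ← hg1, ← integral_sub hφ2 hg2]
    exact (abs_integral_le_integral_abs).trans hφg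
  obtain ⟨hm2, hm3⟩ := abs_le.1 hm1
  have hm0 : 0 < m := by linarith
  have hs : (Real.sqrt m)⁻¹ ^ 2 = m⁻¹ := by rw [inv_pow, Real.sq_sqrt hm0.le]
  refine ⟨fun x => (Real.sqrt m)⁻¹ * φ x, contDiff_const.mul hφ, hφc.mul_left, ?_, ?_, ?_⟩
  · simp only [mul_pow, hs]
    rw [integral_const_mul, ← hm, inv_mul_cancel₀ hm0.ne']
  · simp only [mul_pow, hs]
    have h1 : ∀ x, |m⁻¹ * φ x ^ 2 - g x ^ 2| ≤ |m⁻¹ - 1| * φ x ^ 2 + |φ x ^ 2 - g x ^ 2| := by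
      intro x
      have : m⁻¹ * φ x ^ 2 - g x ^ 2 = (m⁻¹ - 1) * φ x ^ 2 + (φ x ^ 2 - g x ^ 2) := by ring
      rw [this]
      refine (abs_add_le _ _).trans (le_of_eq ?_)
      rw [abs_mul, abs_of_nonneg (sq_nonneg (φ x))]
    have i4 : Integrable (fun x => |m⁻¹ - 1| * φ x ^ 2 + |φ x ^ 2 - g x ^ 2|) μ :=
      (hφ2.const_mul _).add i3
    refine (integral_mono_of_nonneg (Filter.Eventually.of_forall fun x => abs_nonneg _) i4
      (Filter.Eventually.of_forall h1)).trans ?_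
    rw [integral_add (hφ2.const_mul _) i3, integral_const_mul, ← hm]
    have h2 : |m⁻¹ - 1| * m = |m - 1| := by
      have h3 : m⁻¹ - 1 = -(m - 1) / m := by field_simp; ring
      rw [h3, abs_div, abs_neg, abs_of_pos hm0, div_mul_cancel₀ _ hm0.ne']
    linarith
  · have h1 : ∀ x, ‖fderiv ℝ (fun x => (Real.sqrt m)⁻¹ * φ x) x‖ₑ ^ 2 =
        ENNReal.ofReal m⁻¹ * ‖fderiv ℝ φ x‖ₑ ^ 2 := by
      intro x
      rw [fderiv_const_mul (hφ.differentiable one_ne_zero x), ← hs, ← ofReal_norm, ← ofReal_norm,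
        norm_smul, Real.norm_of_nonneg (by positivity), ENNReal.ofReal_mul (by positivity), mul_pow,
        ENNReal.ofReal_pow (by positivity)]
    simp only [h1]
    rw [lintegral_const_mul _ ((measurable_fderiv ℝ φ).enorm.pow_const 2)]
    refine (mul_le_mul_right hφJ.le _).trans ?_
    rw [← ENNReal.ofReal_mul (by positivity)]
    refine ENNReal.ofReal_le_ofReal ?_
    rw [inv_mul_le_iff₀ hm0]
    nlinarith

end Cutoff

section DensitySq
variable {X : Type*} [MeasurableSpace X] {μ : Measure X}

lemma integral_withDensity_sq {φ : X → ℝ} (hφ : Measurable φ) (h : X → ℝ) :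
    ∫ x, h x ∂μ.withDensity (fun x => ENNReal.ofReal (φ x ^ 2)) = ∫ x, φ x ^ 2 * h x ∂μ := by
  rw [integral_withDensity_eq_integral_toReal_smul (hφ.pow_const 2).ennreal_ofReal
    (Filter.Eventually.of_forall fun x => ENNReal.ofReal_lt_top)]
  refine integral_congr_ae (Filter.Eventually.of_forall fun x => ?_)
  simp only [ENNReal.toReal_ofReal (sq_nonneg (φ x)), smul_eq_mul]

lemma isProbabilityMeasure_withDensity_sq {φ : X → ℝ} (hφ1 : ∫ x, φ x ^ 2 ∂μ = 1) :
    IsProbabilityMeasure (μ.withDensity fun x => ENNReal.ofReal (φ x ^ 2)) := by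
  refine ⟨?_⟩
  rw [withDensity_apply _ .univ, Measure.restrict_univ, ← ofReal_integral_eq_lintegral_ofReal
    (by
      by_contra h
      rw [integral_undef h] at hφ1
      exact zero_ne_one hφ1)
    (Filter.Eventually.of_forall fun x => sq_nonneg _), hφ1, ENNReal.ofReal_one]

lemma mul_le_exp_sub_add_mul_log {a : ℝ} (ha : 0 ≤ a) (t : ℝ) :
    a * t ≤ Real.exp t - a + a * Real.log a := by
  rcases ha.eq_or_lt with rfl | ha
  · simpa using (Real.exp_pos t).le
  · have h := Real.log_le_sub_one_of_pos (div_pos (Real.exp_pos t) ha)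
    rw [Real.log_div (Real.exp_pos t).ne' ha.ne', Real.log_exp] at h
    have h2 := mul_le_mul_of_nonneg_left h ha.le
    have h3 : a * (Real.exp t / a - 1) = Real.exp t - a := by field_simp
    linarith

variable [TopologicalSpace X] [BorelSpace X]

lemma entropyDualBound_withDensity_sq [IsProbabilityMeasure μ] {φ : X → ℝ} (hφ : Continuous φ)
    (hφb : ∃ M, ∀ x, |φ x| ≤ M) (hφ1 : ∫ x, φ x ^ 2 ∂μ = 1) {H : ℝ}
    (hH : ∫ x, φ x ^ 2 * Real.log (φ x ^ 2) ∂μ ≤ H) :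
    EntropyDualBound μ (μ.withDensity fun x => ENNReal.ofReal (φ x ^ 2)) H := by
  rintro G hG ⟨K, hK⟩
  obtain ⟨M, hM⟩ := hφb
  have hφ2 : ∀ x, φ x ^ 2 ≤ M ^ 2 := fun x => by
    rw [← sq_abs]
    exact pow_le_pow_left₀ (abs_nonneg _) (hM x) 2
  have i1 : Integrable (fun x => φ x ^ 2) μ :=
    Integrable.of_bound (Continuous.aestronglyMeasurable (hφ.pow 2)) (M ^ 2)
      (Filter.Eventually.of_forall fun x => by
        rw [Real.norm_of_nonneg (sq_nonneg _)]
        exact hφ2 x)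
  have i2 : Integrable (fun x => Real.exp (G x)) μ :=
    Integrable.of_bound (Continuous.aestronglyMeasurable (by fun_prop)) (Real.exp K)
      (Filter.Eventually.of_forall fun x => by
        rw [Real.norm_of_nonneg (Real.exp_pos _).le]
        exact Real.exp_le_exp.2 ((le_abs_self _).trans (hK x)))
  have i3 : Integrable (fun x => φ x ^ 2 * G x) μ :=
    i1.mul_bdd (c := K) hG.aestronglyMeasurable (Filter.Eventually.of_forall hK)
  obtain ⟨C, hC⟩ := (isCompact_Icc (a := (0 : ℝ)) (b := M ^ 2)).exists_bound_of_continuousOn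
    Real.continuous_mul_log.continuousOn
  have i4 : Integrable (fun x => φ x ^ 2 * Real.log (φ x ^ 2)) μ :=
    Integrable.of_bound (Continuous.aestronglyMeasurable
      (Real.continuous_mul_log.comp (hφ.pow 2))) C
      (Filter.Eventually.of_forall fun x => hC _ ⟨sq_nonneg _, hφ2 x⟩)
  rw [integral_withDensity_sq hφ.measurable]
  have h : ∫ x, φ x ^ 2 * G x ∂μ ≤
      ∫ x, (Real.exp (G x) - φ x ^ 2 + φ x ^ 2 * Real.log (φ x ^ 2)) ∂μ :=
    integral_mono i3 ((i2.sub i1).add i4) fun x => mul_le_exp_sub_add_mul_log (sq_nonneg _) _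
  have i5 : Integrable (fun x => Real.exp (G x) - φ x ^ 2) μ := i2.sub i1
  rw [integral_add i5 i4, integral_sub i2 i1, hφ1] at h
  linarith

lemma integral_withDensity_sq_le [IsFiniteMeasure μ] {φ g h : X → ℝ} (hφ : Measurable φ)
    (hg : Measurable g) (hφ2 : Integrable (fun x => φ x ^ 2) μ)
    (hg2 : Integrable (fun x => g x ^ 2) μ) {δ M : ℝ} (hM : 0 ≤ M)
    (hδ : ∫ x, |φ x ^ 2 - g x ^ 2| ∂μ ≤ δ) (hh : Continuous h) (hhM : ∀ x, |h x| ≤ M) :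
    ∫ x, h x ∂μ.withDensity (fun x => ENNReal.ofReal (g x ^ 2)) ≤
      ∫ x, h x ∂μ.withDensity (fun x => ENNReal.ofReal (φ x ^ 2)) + M * δ := by
  rw [integral_withDensity_sq hφ, integral_withDensity_sq hg]
  have i1 : Integrable (fun x => φ x ^ 2 * h x) μ :=
    hφ2.mul_bdd (c := M) hh.aestronglyMeasurable (Filter.Eventually.of_forall hhM)
  have i2 : Integrable (fun x => g x ^ 2 * h x) μ :=
    hg2.mul_bdd (c := M) hh.aestronglyMeasurable (Filter.Eventually.of_forall hhM)
  have i3 : Integrable (fun x => M * |φ x ^ 2 - g x ^ 2|) μ := (hφ2.sub hg2).abs.const_mul _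
  have h1 : ∫ x, g x ^ 2 * h x ∂μ ≤ ∫ x, (φ x ^ 2 * h x + M * |φ x ^ 2 - g x ^ 2|) ∂μ := by
    refine integral_mono i2 (i1.add i3) fun x => ?_
    have h2 : |(φ x ^ 2 - g x ^ 2) * h x| ≤ |φ x ^ 2 - g x ^ 2| * M := by
      rw [abs_mul]
      exact mul_le_mul_of_nonneg_left (hhM x) (abs_nonneg _)
    have h3 := (abs_le.1 h2).1
    simp only
    linarith
  rw [integral_add i1 i3, integral_const_mul] at h1
  have := mul_le_mul_of_nonneg_left hδ hM
  linarith

end DensitySq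

section Main
variable {E : Type*} [NormedAddCommGroup E] [InnerProductSpace ℝ E] [MeasurableSpace E]
  {μ : Measure E} {β : ℝ → ℝ} {r δ : ℝ}

lemma BetaLogSobolev.entropy_le (hLSI : BetaLogSobolev β μ) (hβ : IsAdmissibleRate β) (hr : 0 ≤ r)
    {φ : E → ℝ} (hφ : ContDiff ℝ 1 φ) (hφb : ∃ M, ∀ x, |φ x| ≤ M) (hφ1 : ∫ x, φ x ^ 2 ∂μ = 1)
    (hJ : ∫⁻ x, ‖fderiv ℝ φ x‖ₑ ^ 2 ∂μ ≤ ENNReal.ofReal (β r)) :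
    ∫ x, φ x ^ 2 * Real.log (φ x ^ 2) ∂μ ≤ r := by
  by_contra! hcon
  have h1 := (hLSI φ hφ hφb hφ1).trans hJ
  have h2 := hβ.strictMonoOn hr (hr.trans hcon.le) hcon
  have h3 : 0 ≤ β r := by
    rw [← hβ.zero]
    exact hβ.strictMonoOn.monotoneOn Set.self_mem_Ici hr hr
  rw [ENNReal.ofReal_le_ofReal_iff h3] at h1
  linarith

variable [FiniteDimensional ℝ E] [BorelSpace E] {vol : Measure E} [vol.IsAddHaarMeasure]
  {w : E → ℝ} [IsProbabilityMeasure μ]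

/-- The transport inequality for `ν = g² μ` with `μ(|∇g|²) < β(r)`. -/
theorem BetaLogSobolev.exists_coupling_of_lintegral_lt (hLSI : BetaLogSobolev β μ)
    (hβ : IsAdmissibleRate β) (hw : Continuous w) (hw0 : ∀ x, 0 < w x)
    (hμ : μ = vol.withDensity fun x => ENNReal.ofReal (w x)) (hr : 0 ≤ r) {g : E → ℝ}
    (hg : Differentiable ℝ g) (hg1 : ∫ x, g x ^ 2 ∂μ = 1)
    (hJ : ∫⁻ x, ‖fderiv ℝ g x‖ₑ ^ 2 ∂μ < ENNReal.ofReal (β r)) (hδ : 0 < δ) :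
    ∃ π : Measure (E × E), π.map Prod.fst = μ.withDensity (fun x => ENNReal.ofReal (g x ^ 2)) ∧
      π.map Prod.snd = μ ∧ ∫⁻ q, ENNReal.ofReal (‖q.1 - q.2‖ ^ 2) ∂π ≤
        ENNReal.ofReal ((halfInvSqrtIntegral β r + δ) ^ 2) := by
  have hint : ∀ {φ : E → ℝ}, ∫ x, φ x ^ 2 ∂μ = 1 → Integrable (fun x => φ x ^ 2) μ := by
    intro φ h1
    by_contra h
    rw [integral_undef h] at h1
    exact zero_ne_one h1
  set C := 2 * (halfInvSqrtIntegral β r + 1) ^ 2 + 2 * ∫ x, ‖x‖ ^ 2 ∂μ with hC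
  have happrox : ∀ η : ℝ, 0 < η → ∃ φ : E → ℝ, Continuous φ ∧ ∫ x, φ x ^ 2 ∂μ = 1 ∧
      ∫ x, |φ x ^ 2 - g x ^ 2| ∂μ ≤ η ∧
      EntropyDualBound μ (μ.withDensity fun x => ENNReal.ofReal (φ x ^ 2)) r ∧
      Integrable (fun x => ‖x‖ ^ 2) (μ.withDensity fun x => ENNReal.ofReal (φ x ^ 2)) ∧
      ∫ x, ‖x‖ ^ 2 ∂μ.withDensity (fun x => ENNReal.ofReal (φ x ^ 2)) ≤ C := by
    intro η hη
    obtain ⟨φ, hφ, hφc, hφ1, hφg, hφJ⟩ :=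
      exists_contDiff_approx_integral_eq_one hw hw0 hμ hg hg1 hJ hη
    have hφb : ∃ M, ∀ x, |φ x| ≤ M := hφ.continuous.bounded_above_of_compact_support hφc
    have hent := entropyDualBound_withDensity_sq hφ.continuous hφb hφ1
      (hLSI.entropy_le hβ hr hφ hφb hφ1 hφJ)
    have hprob := isProbabilityMeasure_withDensity_sq hφ1
    have hmom : Integrable (fun x => ‖x‖ ^ 2)
        (μ.withDensity fun x => ENNReal.ofReal (φ x ^ 2)) := by
      rw [integrable_withDensity_iff (hφ.continuous.measurable.pow_const 2).ennreal_ofReal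
        (Filter.Eventually.of_forall fun x => ENNReal.ofReal_lt_top)]
      have hcs : HasCompactSupport fun x => ‖x‖ ^ 2 * (φ x * φ x) := hφc.mul_left.mul_left
      refine ((Continuous.integrable_of_hasCompactSupport (by fun_prop) hcs).congr
        (Filter.Eventually.of_forall fun x => ?_))
      simp only [ENNReal.toReal_ofReal (sq_nonneg (φ x))]
      rw [pow_two (φ x)]
    obtain ⟨hμ2, π, hπ1, hπ2, hπ⟩ := hLSI.exists_coupling hβ hr hent hmom one_pos
    exact ⟨φ, hφ.continuous, hφ1, hφg, hent, hmom,
      integral_norm_sq_le_of_coupling hπ1 hπ2 (by positivity) hπ hμ2⟩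
  have hprob := isProbabilityMeasure_withDensity_sq hg1
  have hgm : Measurable g := hg.continuous.measurable
  refine (hLSI.exists_coupling hβ hr ?_ ?_ hδ).2
  · rintro G hG ⟨M, hM⟩
    have hM0 : 0 ≤ M := (abs_nonneg _).trans (hM 0)
    refine le_of_forall_pos_le_add fun τ hτ => ?_
    obtain ⟨φ, hφ, hφ1, hφg, hent, -⟩ := happrox (τ / (M + 1)) (by positivity)
    have h1 := integral_withDensity_sq_le hφ.measurable hgm (hint hφ1) (hint hg1) hM0 hφg hG hM
    have h2 := hent G hG ⟨M, hM⟩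
    have h3 : M * (τ / (M + 1)) ≤ τ := by
      rw [mul_div_assoc', div_le_iff₀ (by positivity)]
      nlinarith
    linarith
  · refine (integrable_of_integral_min_le (C := C) (by fun_prop)
      (fun x => by positivity) fun k => ?_).1
    refine le_of_forall_pos_le_add fun τ hτ => ?_
    obtain ⟨φ, hφ, hφ1, hφg, -, hmom, hle⟩ := happrox (τ / (k + 1)) (by positivity)
    have hk : (0 : ℝ) ≤ k := k.cast_nonneg
    have h0 : ∀ x : E, 0 ≤ min (‖x‖ ^ 2) (k : ℝ) := fun x => le_min (by positivity) hk
    have h1 := integral_withDensity_sq_le hφ.measurable hgm (hint hφ1) (hint hg1) hk hφg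
      (h := fun x => min (‖x‖ ^ 2) (k : ℝ)) (by fun_prop) fun x => by
        rw [abs_of_nonneg (h0 x)]
        exact min_le_right _ _
    have h2 := integral_mono_of_nonneg (Filter.Eventually.of_forall h0) hmom
      (Filter.Eventually.of_forall fun x => min_le_left _ _)
    have h3 : k * (τ / (k + 1)) ≤ τ := by
      rw [mul_div_assoc', div_le_iff₀ (by positivity)]
      nlinarith
    linarith

end Main

section Wasserstein
variable {n : ℕ}

lemma nnnorm_gradient (g : EuclideanSpace ℝ (Fin n) → ℝ) (x : EuclideanSpace ℝ (Fin n)) :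
    (‖gradient g x‖₊ : ℝ≥0∞) = ‖fderiv ℝ g x‖ₑ := by
  rw [← enorm_eq_nnnorm, ← ofReal_norm, ← ofReal_norm, gradient, LinearIsometryEquiv.norm_map]

lemma wassersteinDist_two_le_of_coupling
    {π : Measure (EuclideanSpace ℝ (Fin n) × EuclideanSpace ℝ (Fin n))}
    {ν μ : Measure (EuclideanSpace ℝ (Fin n))} (hπ : IsCoupling π ν μ) {a : ℝ} (ha : 0 ≤ a)
    (h : ∫⁻ q, ENNReal.ofReal (‖q.1 - q.2‖ ^ 2) ∂π ≤ ENNReal.ofReal (a ^ 2)) :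
    wassersteinDist 2 ν μ ≤ ENNReal.ofReal a := by
  have h1 : ∫⁻ q, edist q.1 q.2 ^ (2 : ℝ) ∂π ≤ ENNReal.ofReal (a ^ 2) := by
    simpa only [edist_dist, dist_eq_norm, ENNReal.rpow_two,
      ← ENNReal.ofReal_pow (norm_nonneg _)] using h
  refine (ENNReal.rpow_le_rpow ((iInf₂_le π hπ).trans h1) (by norm_num)).trans_eq ?_
  rw [ENNReal.ofReal_pow ha, ← ENNReal.rpow_two, ← ENNReal.rpow_mul]
  norm_num

end Wasserstein

/-- **Theorem 4.1 (1)**: the `β`-log-Sobolev inequality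
`β(μ(g² log g²)) ≤ μ(|∇g|²)` implies `α(W₂(ν,μ)) ≤ I(ν|μ)` with
`α = β ∘ γ^{-1}`, `γ(r) = ½∫₀^r ds/√β(s)`.  The conclusion is encoded
(via strict monotonicity and continuity of `γ` and `β`) as:
`γ(r) ≤ W₂(ν,μ)` implies `β(r) ≤ I(ν|μ)` for all `r ≥ 0`. -/
theorem beta_logSobolev_implies_alphaW2I {n : ℕ}
    (V : EuclideanSpace ℝ (Fin n) → ℝ) (hV : Continuous V) (Z : ℝ) (hZ : 0 < Z)
    (μ : Measure (EuclideanSpace ℝ (Fin n)))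
    (hμ : μ = volume.withDensity fun x => ENNReal.ofReal (Real.exp (-V x) / Z))
    (hμprob : IsProbabilityMeasure μ)
    (β : ℝ → ℝ) (hβcont : ContinuousOn β (Set.Ici 0))
    (hβmono : StrictMonoOn β (Set.Ici 0)) (hβ0 : β 0 = 0)
    (hγfin : ∀ r : ℝ, 0 < r →
      IntervalIntegrable (fun s => 1 / Real.sqrt (β s)) volume 0 r)
    (hLSI : ∀ g : EuclideanSpace ℝ (Fin n) → ℝ, ContDiff ℝ 1 g →
      (∃ M, ∀ x, |g x| ≤ M) → (∫ x, g x ^ 2 ∂μ) = 1 →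
      ENNReal.ofReal (β (∫ x, g x ^ 2 * Real.log (g x ^ 2) ∂μ)) ≤
        ∫⁻ x, (‖gradient g x‖₊ : ℝ≥0∞) ^ 2 ∂μ) :
    ∀ ν : Measure (EuclideanSpace ℝ (Fin n)), IsProbabilityMeasure ν →
      ∀ r : ℝ, 0 ≤ r →
      ENNReal.ofReal ((1 / 2) * ∫ s in (0:ℝ)..r, 1 / Real.sqrt (β s)) ≤
        wassersteinDist 2 ν μ →
      ENNReal.ofReal (β r) ≤ fisherInfo ν μ := by
  intro ν hν r hr hW
  have hβ : IsAdmissibleRate β := ⟨hβcont, hβmono, hβ0, hγfin⟩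
  have hLSI' : BetaLogSobolev β μ := fun g hg hgb hg1 => by
    simpa only [nnnorm_gradient] using hLSI g hg hgb hg1
  refine le_iInf fun f => le_iInf fun hf0 => le_iInf fun hνf => le_iInf fun hdiff => ?_
  by_contra! hJ
  simp only [nnnorm_gradient] at hJ
  have hsq : ∀ x, Real.sqrt (f x) ^ 2 = f x := fun x => Real.sq_sqrt (hf0 x)
  have hg1 : ∫ x, Real.sqrt (f x) ^ 2 ∂μ = 1 := by
    rw [integral_eq_lintegral_of_nonneg_ae (Filter.Eventually.of_forall fun x => sq_nonneg _)
      (hdiff.continuous.pow 2).aestronglyMeasurable]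
    simp only [hsq]
    have h1 := hν.measure_univ
    rw [hνf, withDensity_apply _ .univ, Measure.restrict_univ] at h1
    rw [h1, ENNReal.toReal_one]
  rcases hr.eq_or_lt with rfl | hr
  · simp [hβ0] at hJ
  have hcont : ContinuousAt (fun s => ENNReal.ofReal (β s)) r :=
    ENNReal.continuous_ofReal.continuousAt.comp (hβcont.continuousAt (Ici_mem_nhds hr))
  obtain ⟨r', hJ', hr'0, hr'r⟩ := (((hcont.eventually_const_lt hJ).filter_mono
    nhdsWithin_le_nhds).and (Ioo_mem_nhdsLT hr)).exists
  have hγ := hβ.strictMonoOn_halfInvSqrtIntegral hr'0.le hr.le hr'r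
  have hγ0 := hβ.nonneg hr'0.le
  set δ := (halfInvSqrtIntegral β r - halfInvSqrtIntegral β r') / 2 with hδ
  have hδ0 : 0 < δ := by linarith
  obtain ⟨π, hπ1, hπ2, hπ⟩ := hLSI'.exists_coupling_of_lintegral_lt hβ
    (by fun_prop : Continuous fun x => Real.exp (-V x) / Z)
    (fun x => div_pos (Real.exp_pos _) hZ) hμ hr'0.le hdiff hg1 hJ' hδ0
  simp only [hsq, ← hνf] at hπ1
  have hW2 := hW.trans (wassersteinDist_two_le_of_coupling ⟨hπ1, hπ2⟩ (by linarith) hπ)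
  rw [ENNReal.ofReal_le_ofReal_iff (by linarith)] at hW2
  have : halfInvSqrtIntegral β r ≤ halfInvSqrtIntegral β r' + δ := hW2
  linarith
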